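/- Let Ω ∈ K^n/ℤ^n and 𝒟_Ω = ∅; take 𝔪 ∈ Ω if 𝔻_Ω = ∅ and 𝔪 = (H_1,…,H_l, H_{l+1}−λ_{l+1},…,H_n−λ_n) if 𝔻_Ω = {1,…,l} ≠ ∅ (up to order). Then the functor GW(𝕀_n, 𝒟_Ω) → LF_𝔪(D_n), M ↦ M^𝔪, is an equivalence of categories, with inverse the induction functor N ↦ B_n ⊗_{D_n} N. -/

import Mathlib

set_option maxHeartbeats 1000000
set_option synthInstance.maxHeartbeats 400000
set_option linter.unusedSectionVars false

namespace IDO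

open scoped TensorProduct

noncomputable section

variable (K : Type*) [Field K] [CharZero K] (n : ℕ)

/-- The polynomial algebra `P_n = K[x_1, …, x_n]`. -/
abbrev P := MvPolynomial (Fin n) K

/-- The multiplication operator `x_i`. -/
def xOp (i : Fin n) : Module.End K (P K n) := LinearMap.mulLeft K (MvPolynomial.X i)

/-- The partial derivative `∂_i`. -/
def dOp (i : Fin n) : Module.End K (P K n) := (MvPolynomial.pderiv i).toLinearMap

/-- The integration operator `∫_i`, sending `x^α ↦ x^{α+e_i}/(α_i+1)`. -/
def intOp (i : Fin n) : Module.End K (P K n) :=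
  ((MvPolynomial.basisMonomials (Fin n) K).constr K)
    (fun α => (((α i : ℕ) : K) + 1)⁻¹ •
      (MvPolynomial.monomial (α + Finsupp.single i 1) (1 : K)))

/-- The algebra of polynomial integro-differential operators `𝕀_n`, as a subalgebra of
`End_K(P_n)` generated by the `x_i`, `∂_i` and `∫_i`. -/
def InSub : Subalgebra K (Module.End K (P K n)) :=
  Algebra.adjoin K (Set.range (xOp K n) ∪ Set.range (dOp K n) ∪ Set.range (intOp K n))

/-- The algebra `𝕀_n` (as a type, with its canonical ring structure). -/
def In : Type _ := InSub K n

instance : Ring (In K n) := inferInstanceAs (Ring (InSub K n))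
instance : Algebra K (In K n) := inferInstanceAs (Algebra K (InSub K n))
instance : Module (In K n) (P K n) := inferInstanceAs (Module (InSub K n) (P K n))
instance : IsScalarTower K (In K n) (P K n) :=
  inferInstanceAs (IsScalarTower K (InSub K n) (P K n))

/-- `x_i` as an element of `𝕀_n`. -/
def xEl (i : Fin n) : In K n :=
  show InSub K n from
    ⟨xOp K n i, Algebra.subset_adjoin (Set.mem_union_left _ (Set.mem_union_left _ ⟨i, rfl⟩))⟩

/-- `∂_i` as an element of `𝕀_n`. -/
def dEl (i : Fin n) : In K n :=
  show InSub K n from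
    ⟨dOp K n i, Algebra.subset_adjoin (Set.mem_union_left _ (Set.mem_union_right _ ⟨i, rfl⟩))⟩

/-- `∫_i` as an element of `𝕀_n`. -/
def intEl (i : Fin n) : In K n :=
  show InSub K n from
    ⟨intOp K n i, Algebra.subset_adjoin (Set.mem_union_right _ ⟨i, rfl⟩)⟩

/-- `H_i = ∂_i x_i` as an element of `𝕀_n`. -/
def HEl (i : Fin n) : In K n := dEl K n i * xEl K n i

section Modules

variable (M : Type*) [AddCommGroup M] [Module K M] [Module (In K n) M]
  [IsScalarTower K (In K n) M]

/-- The weight space `M_λ = {m | H_i m = λ_i m for all i}`. -/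
def weightSpace (lam : Fin n → K) : Submodule K M where
  carrier := {m | ∀ i, HEl K n i • m = lam i • m}
  add_mem' := by
    intro a b ha hb i
    rw [smul_add, ha i, hb i, smul_add]
  zero_mem' := by intro i; simp
  smul_mem' := by
    intro c m hm i
    rw [← smul_comm c (HEl K n i) m, hm i, smul_smul, mul_comm, ← smul_smul]

private lemma pow_smul_zero_mono {a : In K n} {m : M} {s s' : ℕ}
    (h : (a ^ s) • m = 0) (hle : s ≤ s') : (a ^ s') • m = 0 := by
  obtain ⟨k, rfl⟩ := Nat.exists_eq_add_of_le hle
  rw [add_comm s k, pow_add, mul_smul, h, smul_zero]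

/-- The generalized weight space `M^λ = {m | (H_i − λ_i)^N m = 0 for some N and all i}`. -/
def genWeightSpace (lam : Fin n → K) : Submodule K M where
  carrier := {m | ∃ N : ℕ, ∀ i,
    ((HEl K n i - algebraMap K (In K n) (lam i)) ^ N) • m = 0}
  add_mem' := by
    rintro a b ⟨Na, ha⟩ ⟨Nb, hb⟩
    refine ⟨Na ⊔ Nb, fun i => ?_⟩
    rw [smul_add, pow_smul_zero_mono K n M (ha i) le_sup_left,
      pow_smul_zero_mono K n M (hb i) le_sup_right, add_zero]
  zero_mem' := ⟨0, fun i => smul_zero _⟩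
  smul_mem' := by
    rintro c m ⟨N, hN⟩
    exact ⟨N, fun i => by rw [← smul_comm c _ m, hN i, smul_zero]⟩

/-- `M` is a weight module: `M = ⊕_λ M_λ`. -/
def IsWeightModule : Prop :=
  letI := Classical.decEq (Fin n → K)
  DirectSum.IsInternal (fun lam : Fin n → K => weightSpace K n M lam)

/-- `M` is a generalized weight module: `M = ⊕_λ M^λ`. -/
def IsGenWeightModule : Prop :=
  letI := Classical.decEq (Fin n → K)
  DirectSum.IsInternal (fun lam : Fin n → K => genWeightSpace K n M lam)

/-- The support `Supp(M) = {λ | M^λ ≠ 0}`. -/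
def supp : Set (Fin n → K) := {lam | genWeightSpace K n M lam ≠ ⊥}

/-- `M` is an indecomposable `𝕀_n`-module. -/
def IsIndecomposableMod : Prop :=
  Nontrivial M ∧ ∀ p q : Submodule (In K n) M, IsCompl p q → p = ⊥ ∨ q = ⊥

/-- The annihilator of an `𝕀_n`-module, as a set. -/
def annSet : Set (In K n) := {a | ∀ m : M, a • m = 0}

end Modules

/-- A prime (two-sided) ideal of the noncommutative ring `𝕀_n`, given as a set:
`S ≠ 𝕀_n` and `a 𝕀_n b ⊆ S → a ∈ S ∨ b ∈ S`. -/
def IsPrimeSet (S : Set (In K n)) : Prop :=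
  S ≠ Set.univ ∧ ∀ a b : In K n, (∀ r : In K n, a * r * b ∈ S) → a ∈ S ∨ b ∈ S

-- orbits
/-- The `ℤ^n`-orbit of `λ ∈ K^n`. -/
def orbitOf (lam : Fin n → K) : Set (Fin n → K) :=
  {mu | ∀ i, ∃ z : ℤ, mu i - lam i = (z : K)}

/-- The setoid on `K^n` whose classes are the `ℤ^n`-orbits. -/
def orbitSetoid : Setoid (Fin n → K) where
  r mu nu := ∀ i, ∃ z : ℤ, mu i - nu i = (z : K)
  iseqv := by
    constructor
    · intro x i; exact ⟨0, by simp⟩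
    · intro x y h i
      obtain ⟨z, hz⟩ := h i
      exact ⟨-z, by push_cast; linear_combination -hz⟩
    · intro x y z hxy hyz i
      obtain ⟨a, ha⟩ := hxy i
      obtain ⟨b, hb⟩ := hyz i
      exact ⟨a + b, by push_cast; linear_combination ha + hb⟩

/-- `𝔻_Ω = {i | Ω_i = ℤ}` for the orbit `Ω` of `λ`. -/
def DD (lam : Fin n → K) : Set (Fin n) := {i | ∃ z : ℤ, lam i = (z : K)}

/-- `λ` is the normalized representative of its orbit: integer coordinates are `0`. -/
def IsNormalized (lam : Fin n → K) : Prop := ∀ i, (∃ z : ℤ, lam i = (z : K)) → lam i = 0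


-- I_1 specifics
/-- The matrix units `e_{st} = ∫^s ∂^t − ∫^{s+1} ∂^{t+1}` of `𝕀_1`. -/
def eEl1 (s t : ℕ) : In K 1 :=
  intEl K 1 0 ^ s * dEl K 1 0 ^ t - intEl K 1 0 ^ (s + 1) * dEl K 1 0 ^ (t + 1)

/-- `F = ⊕ K e_{st}`, the unique proper two-sided ideal of `𝕀_1`, here as the left ideal
generated by the `e_{st}` (the two coincide). -/
def Fideal : Submodule (In K 1) (In K 1) :=
  Submodule.span (In K 1) {a | ∃ s t : ℕ, a = eEl1 K s t}

/-- The left ideal `F + 𝕀_1 (H − μ)^s`. -/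
def MslIdeal (s : ℕ) (mu : K) : Submodule (In K 1) (In K 1) :=
  Fideal K ⊔ Submodule.span (In K 1) {(HEl K 1 0 - algebraMap K (In K 1) mu) ^ s}

/-- The `𝕀_1`-module `M(s,μ) = 𝕀_1/(F + 𝕀_1 (H − μ)^s)`. -/
def Msl (s : ℕ) (mu : K) := (In K 1) ⧸ MslIdeal K s mu

instance (s : ℕ) (mu : K) : AddCommGroup (Msl K s mu) :=
  inferInstanceAs (AddCommGroup ((In K 1) ⧸ MslIdeal K s mu))
instance (s : ℕ) (mu : K) : Module (In K 1) (Msl K s mu) :=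
  inferInstanceAs (Module (In K 1) ((In K 1) ⧸ MslIdeal K s mu))
instance (s : ℕ) (mu : K) : Module K (Msl K s mu) :=
  inferInstanceAs (Module K ((In K 1) ⧸ MslIdeal K s mu))
instance (s : ℕ) (mu : K) : IsScalarTower K (In K 1) (Msl K s mu) :=
  inferInstanceAs (IsScalarTower K (In K 1) ((In K 1) ⧸ MslIdeal K s mu))

-- two-sided ideals of I_n
/-- The element `e_{st}(i) ∈ 𝕀_n` built from the `i`-th tensor factor. -/
def eElN (i : Fin n) (s t : ℕ) : In K n :=
  intEl K n i ^ s * dEl K n i ^ t - intEl K n i ^ (s + 1) * dEl K n i ^ (t + 1)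

/-- The height one prime `𝔭_i`, the two-sided ideal of `𝕀_n` generated by `F(i)`. -/
def pIdeal (i : Fin n) : TwoSidedIdeal (In K n) :=
  TwoSidedIdeal.span {a | ∃ s t : ℕ, a = eElN K n i s t}

/-- `𝔞_n(I) = Σ_{i ∈ I} 𝔭_i`. -/
def aIdeal (I : Set (Fin n)) : TwoSidedIdeal (In K n) := ⨆ i ∈ I, pIdeal K n i


-- bundled modules
universe u

/-- A bundled `𝕀_n`-module (with compatible `K`-structure). -/
structure ModN (K : Type u) [Field K] [CharZero K] (n : ℕ) : Type (u + 1) where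
  carrier : Type u
  [instAdd : AddCommGroup carrier]
  [instK : Module K carrier]
  [instIn : Module (In K n) carrier]
  [instTower : IsScalarTower K (In K n) carrier]

attribute [instance] ModN.instAdd ModN.instK ModN.instIn ModN.instTower

/-- The endomorphism of `M_1 ⊗ ⋯ ⊗ M_n` acting by `a ∈ 𝕀_1` on the `i`-th factor. -/
def tprodMap (Mi : Fin n → ModN K 1) (i : Fin n) (a : In K 1) :
    (⨂[K] j, (Mi j).carrier) →ₗ[K] ⨂[K] j, (Mi j).carrier :=
  PiTensorProduct.map (Function.update
    (fun j => (LinearMap.id : (Mi j).carrier →ₗ[K] (Mi j).carrier)) i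
    (DistribMulAction.toLinearMap K ((Mi i).carrier) a))

/-- The `𝕀_n`-module `M` "is" the tensor product `M_1 ⊗ ⋯ ⊗ M_n` of the `𝕀_1`-modules `M_i`:
there is a `K`-linear isomorphism under which the generators `x_i, ∂_i, ∫_i` of `𝕀_n` act on
the `i`-th tensor factor via the corresponding generators of `𝕀_1`. -/
def RealizesTensor (Mi : Fin n → ModN K 1) (M : Type*) [AddCommGroup M] [Module K M]
    [Module (In K n) M] [IsScalarTower K (In K n) M] : Prop :=
  ∃ φ : M ≃ₗ[K] ⨂[K] j, (Mi j).carrier,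
    ∀ (i : Fin n) (m : M),
      φ (xEl K n i • m) = tprodMap K n Mi i (xEl K 1 0) (φ m) ∧
      φ (dEl K n i • m) = tprodMap K n Mi i (dEl K 1 0) (φ m) ∧
      φ (intEl K n i • m) = tprodMap K n Mi i (intEl K 1 0) (φ m)

/-- `M` is (isomorphic to) the simple weight module `M(𝒟_Ω)` attached to the orbit of `λ`
and the subset `𝒟 ⊆ 𝔻_Ω`: the tensor product of copies of `K[x]` (for `i ∈ 𝒟`) and of
`M(1, λ_i)` (for `i ∉ 𝒟`). -/
def RealizesMD (lam : Fin n → K) (D : Set (Fin n)) (M : Type*) [AddCommGroup M] [Module K M]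
    [Module (In K n) M] [IsScalarTower K (In K n) M] : Prop :=
  ∃ Mi : Fin n → ModN K 1,
    (∀ i, i ∈ D → Nonempty ((Mi i).carrier ≃ₗ[In K 1] P K 1)) ∧
    (∀ i, i ∉ D → Nonempty ((Mi i).carrier ≃ₗ[In K 1] Msl K 1 (lam i))) ∧
    RealizesTensor K n Mi M

/-- `M` is (isomorphic to) the module `P_{n-1} ⊗ M(s, λ)` (with the copy of `M(s,λ)` placed
in position `j`). -/
def RealizesPMs (lam : Fin n → K) (j : Fin n) (s : ℕ) (M : Type*) [AddCommGroup M] [Module K M]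
    [Module (In K n) M] [IsScalarTower K (In K n) M] : Prop :=
  ∃ Mi : Fin n → ModN K 1,
    (∀ i, i ≠ j → Nonempty ((Mi i).carrier ≃ₗ[In K 1] P K 1)) ∧
    Nonempty ((Mi j).carrier ≃ₗ[In K 1] Msl K s (lam j)) ∧
    RealizesTensor K n Mi M

/-- Membership in the category `GW(𝕀_n, 𝒟_Ω)`: generalized weight modules with support in the
orbit of `λ` all of whose simple subquotients are isomorphic to `M(𝒟_Ω)`. -/
def InGWD (lam : Fin n → K) (D : Set (Fin n)) (M : Type*) [AddCommGroup M] [Module K M]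
    [Module (In K n) M] [IsScalarTower K (In K n) M] : Prop :=
  IsGenWeightModule K n M ∧ supp K n M ⊆ orbitOf K n lam ∧
  ∀ (p q : Submodule (In K n) M), p ≤ q →
    IsSimpleModule (In K n) (q ⧸ Submodule.comap q.subtype p) →
    RealizesMD K n lam D (q ⧸ Submodule.comap q.subtype p)

/-- The support `S(𝒟_Ω) = ℕ_+^{𝒟_Ω} × ∏_{i ∉ 𝒟_Ω} (λ_i + ℤ)` of the module `M(𝒟_Ω)`. -/
def SuppMD (lam : Fin n → K) (D : Set (Fin n)) : Set (Fin n → K) :=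
  {mu | (∀ i ∈ D, ∃ m : ℕ, 0 < m ∧ mu i = (m : K)) ∧
        (∀ i ∉ D, ∃ z : ℤ, mu i = lam i + (z : K))}

/-- `M` is an absolutely prime `𝕀_n`-module: its annihilator is a prime ideal and every
nonzero subfactor of `M` has the same annihilator. -/
def IsAbsolutelyPrime (M : Type*) [AddCommGroup M] [Module K M]
    [Module (In K n) M] [IsScalarTower K (In K n) M] : Prop :=
  IsPrimeSet K n (annSet K n M) ∧
  ∀ (p q : Submodule (In K n) M), p ≤ q →
    Nontrivial (q ⧸ Submodule.comap q.subtype p) →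
    annSet K n (q ⧸ Submodule.comap q.subtype p) = annSet K n M


-- the commutative subalgebra D_n = K[H_1, …, H_n]
lemma xEl_smul (i : Fin n) (p : P K n) : xEl K n i • p = MvPolynomial.X i * p := rfl

lemma dEl_smul (i : Fin n) (p : P K n) : dEl K n i • p = MvPolynomial.pderiv i p := rfl

lemma hEl_monomial (i : Fin n) (α : Fin n →₀ ℕ) (c : K) :
    HEl K n i • (MvPolynomial.monomial α c : P K n)
      = (((α i : ℕ) : K) + 1) • MvPolynomial.monomial α c := by
  have hx : xEl K n i • (MvPolynomial.monomial α c : P K n)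
      = MvPolynomial.monomial (α + Finsupp.single i 1) c := by
    rw [xEl_smul, MvPolynomial.X, MvPolynomial.monomial_mul, one_mul, add_comm]
  rw [HEl, mul_smul, hx, dEl_smul, MvPolynomial.pderiv_monomial,
    add_tsub_cancel_right, MvPolynomial.smul_monomial, Finsupp.add_apply,
    Finsupp.single_eq_same, smul_eq_mul]
  congr 1
  push_cast
  ring

private lemma In_ext {a b : In K n} (h : ∀ p : P K n, a • p = b • p) : a = b := by
  have : (show InSub K n from a) = (show InSub K n from b) :=
    Subtype.ext (LinearMap.ext fun p => h p)
  exact this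

lemma hEl_comm (i j : Fin n) : HEl K n i * HEl K n j = HEl K n j * HEl K n i := by
  apply In_ext
  intro p
  induction p using MvPolynomial.induction_on' with
  | monomial α c =>
      have key : ∀ a b : Fin n, (HEl K n a * HEl K n b) • (MvPolynomial.monomial α c : P K n)
          = ((((α b : ℕ) : K) + 1) * (((α a : ℕ) : K) + 1)) • MvPolynomial.monomial α c := by
        intro a b
        rw [mul_smul, hEl_monomial, ← smul_comm, hEl_monomial, smul_smul]
      rw [key, key, mul_comm]
  | add p q hp hq =>
      rw [smul_add, smul_add, hp, hq]

/-- `D_n = K[H_1, …, H_n]` as a subalgebra of `𝕀_n`. -/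
def DnSub : Subalgebra K (In K n) := Algebra.adjoin K (Set.range (HEl K n))

/-- The commutative algebra `D_n` (as a type). -/
def Dn : Type _ := DnSub K n

instance : CommRing (Dn K n) :=
  Algebra.adjoinCommRingOfComm K (by rintro a ⟨i, rfl⟩ b ⟨j, rfl⟩; exact hEl_comm K n i j)

instance : Algebra K (Dn K n) := inferInstanceAs (Algebra K (DnSub K n))

/-- The inclusion `D_n → 𝕀_n`. -/
def dnVal : Dn K n →+* In K n := ((DnSub K n).val : DnSub K n →ₐ[K] In K n).toRingHom

/-- `H_i` as an element of `D_n`. -/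
def HElD (i : Fin n) : Dn K n :=
  show DnSub K n from ⟨HEl K n i, Algebra.subset_adjoin ⟨i, rfl⟩⟩

lemma dn_comm (d : Dn K n) (i : Fin n) :
    dnVal K n d * HEl K n i = HEl K n i * dnVal K n d := by
  have h1 : DnSub K n ≤ Subalgebra.centralizer K (Set.range (HEl K n)) := by
    apply Algebra.adjoin_le
    rintro x ⟨j, rfl⟩
    rw [SetLike.mem_coe, Subalgebra.mem_centralizer_iff]
    rintro g ⟨i', rfl⟩
    exact hEl_comm K n i' j
  have h2 := (Subalgebra.mem_centralizer_iff K).mp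
    (h1 (show DnSub K n from d).2) (HEl K n i) ⟨i, rfl⟩
  exact h2.symm


section DnModules

variable (M : Type*) [AddCommGroup M] [Module K M] [Module (In K n) M]
  [IsScalarTower K (In K n) M]

lemma genWS_stable (lam : Fin n → K) {m : M} (hm : m ∈ genWeightSpace K n M lam)
    (d : Dn K n) : dnVal K n d • m ∈ genWeightSpace K n M lam := by
  obtain ⟨N, hN⟩ := hm
  refine ⟨N, fun i => ?_⟩
  have hc : Commute (dnVal K n d) ((HEl K n i - algebraMap K (In K n) (lam i)) ^ N) := by
    apply Commute.pow_right
    exact Commute.sub_right (dn_comm K n d i) ((Algebra.commutes (lam i) (dnVal K n d)).symm)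
  rw [← mul_smul, ← hc.eq, mul_smul, hN i, smul_zero]

instance genWS_smul (lam : Fin n → K) : SMul (Dn K n) (genWeightSpace K n M lam) :=
  ⟨fun d w => ⟨dnVal K n d • (w : M), genWS_stable K n M lam w.2 d⟩⟩

instance genWS_module (lam : Fin n → K) : Module (Dn K n) (genWeightSpace K n M lam) :=
  Module.ofMinimalAxioms
    (fun d x y => Subtype.ext (smul_add (dnVal K n d) (x : M) (y : M)))
    (fun d d' x => Subtype.ext (show dnVal K n (d + d') • (x : M)
      = dnVal K n d • (x : M) + dnVal K n d' • (x : M) by rw [map_add, add_smul]))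
    (fun d d' x => Subtype.ext (show dnVal K n (d * d') • (x : M)
      = dnVal K n d • (dnVal K n d' • (x : M)) by rw [map_mul, mul_smul]))
    (fun x => Subtype.ext (show dnVal K n 1 • (x : M) = (x : M) by rw [map_one, one_smul]))

instance genWS_tower (lam : Fin n → K) :
    IsScalarTower K (Dn K n) (genWeightSpace K n M lam) :=
  ⟨fun c d w => Subtype.ext (show dnVal K n (c • d) • (w : M) = c • (dnVal K n d • (w : M)) by
    rw [show dnVal K n (c • d) = c • dnVal K n d from map_smul (DnSub K n).val c d, smul_assoc])⟩

end DnModules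

/-- The maximal ideal `𝔪_λ = (H_1 − λ_1, …, H_n − λ_n)` of `D_n`. -/
def mIdeal (lam : Fin n → K) : Ideal (Dn K n) :=
  Ideal.span {d | ∃ i, d = HElD K n i - algebraMap K (Dn K n) (lam i)}

/-- The category `LF_𝔪(D_n)` of `𝔪_λ`-locally finite `D_n`-modules: every cyclic submodule is
finite dimensional over `K` and annihilated by a power of `𝔪_λ`. -/
def IsLF (lam : Fin n → K) (N : Type*) [AddCommGroup N] [Module K N] [Module (Dn K n) N]
    [IsScalarTower K (Dn K n) N] : Prop :=
  ∀ x : N, FiniteDimensional K ((Submodule.span (Dn K n) {x}).restrictScalars K) ∧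
    ∃ s : ℕ, ∀ i, ((HElD K n i - algebraMap K (Dn K n) (lam i)) ^ s) • x = 0

-- the algebra B_n = 𝕀_n/𝔞_n
/-- The maximal ideal `𝔞_n = 𝔭_1 + ⋯ + 𝔭_n` of `𝕀_n`. -/
def aFull : TwoSidedIdeal (In K n) := aIdeal K n Set.univ

/-- The skew Laurent polynomial algebra `B_n = 𝕀_n/𝔞_n`. -/
def Bn : Type _ := (aFull K n).ringCon.Quotient

instance : Ring (Bn K n) := inferInstanceAs (Ring (aFull K n).ringCon.Quotient)

/-- The quotient map `𝕀_n → B_n`. -/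
def toBn : In K n →+* Bn K n := RingCon.mk' _

lemma toBn_surjective : Function.Surjective (toBn K n) :=
  Quotient.mk''_surjective

/-- The composite `D_n → 𝕀_n → B_n`. -/
def bnD : Dn K n →+* Bn K n := (toBn K n).comp (dnVal K n)

/-- `B_n` as a right `D_n`-module (written as a left module structure, `d • b = b ⬝ d`). -/
instance : SMul (Dn K n) (Bn K n) := ⟨fun d b => b * bnD K n d⟩

instance : Module (Dn K n) (Bn K n) :=
  Module.ofMinimalAxioms
    (fun d x y => show (x + y) * bnD K n d = x * bnD K n d + y * bnD K n d from add_mul _ _ _)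
    (fun d d' x => show x * bnD K n (d + d') = x * bnD K n d + x * bnD K n d' by
      rw [map_add, mul_add])
    (fun d d' x => show x * bnD K n (d * d') = (x * bnD K n d') * bnD K n d by
      rw [mul_comm d d', map_mul, ← mul_assoc])
    (fun x => show x * bnD K n 1 = x by rw [map_one, mul_one])

instance : SMulCommClass (Dn K n) (Bn K n) (Bn K n) :=
  ⟨fun d b m => show (b * m) * bnD K n d = b * (m * bnD K n d) from mul_assoc b m (bnD K n d)⟩

/-- The induced module `B_n ⊗_{D_n} N` of a `D_n`-module `N`. -/
def Ind (N : Type*) [AddCommGroup N] [Module (Dn K n) N] : Type _ :=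
  (Bn K n) ⊗[Dn K n] N

section Ind

variable (N : Type*) [AddCommGroup N] [Module (Dn K n) N]

instance : AddCommGroup (Ind K n N) :=
  inferInstanceAs (AddCommGroup ((Bn K n) ⊗[Dn K n] N))

instance indModuleBn : Module (Bn K n) (Ind K n N) :=
  inferInstanceAs (Module (Bn K n) ((Bn K n) ⊗[Dn K n] N))

instance indModuleDn : Module (Dn K n) (Ind K n N) :=
  inferInstanceAs (Module (Dn K n) ((Bn K n) ⊗[Dn K n] N))

instance indModuleIn : Module (In K n) (Ind K n N) := Module.compHom _ (toBn K n)

instance indModuleK : Module K (Ind K n N) := Module.compHom _ (algebraMap K (Dn K n))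

lemma bn_algebraMap_comm (c : K) (u : Bn K n) :
    toBn K n (algebraMap K (In K n) c) * u = u * toBn K n (algebraMap K (In K n) c) := by
  obtain ⟨r, rfl⟩ := toBn_surjective K n u
  rw [← map_mul, ← map_mul, Algebra.commutes]

lemma dnVal_algebraMap (c : K) :
    dnVal K n (algebraMap K (Dn K n) c) = algebraMap K (In K n) c :=
  AlgHom.commutes (DnSub K n).val c

lemma ind_key (c : K) (w : (Bn K n) ⊗[Dn K n] N) :
    (toBn K n (algebraMap K (In K n) c)) • w = (algebraMap K (Dn K n) c) • w := by
  induction w using TensorProduct.induction_on with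
  | zero => rw [smul_zero, smul_zero]
  | tmul b x =>
      rw [TensorProduct.smul_tmul', TensorProduct.smul_tmul']
      congr 1
      show toBn K n (algebraMap K (In K n) c) * b = b * bnD K n (algebraMap K (Dn K n) c)
      have h1 : bnD K n (algebraMap K (Dn K n) c) = toBn K n (algebraMap K (In K n) c) := by
        show toBn K n (dnVal K n (algebraMap K (Dn K n) c)) = _
        rw [dnVal_algebraMap]
      rw [h1, bn_algebraMap_comm]
  | add x y hx hy => rw [smul_add, smul_add, hx, hy]

instance indTower : IsScalarTower K (In K n) (Ind K n N) := by
  constructor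
  intro c a v
  show toBn K n (c • a) • v = algebraMap K (Dn K n) c • ((toBn K n a : Bn K n) • v)
  rw [Algebra.smul_def, map_mul, mul_smul]
  exact ind_key K n N c _

end Ind


section BnQuot

variable (J : Submodule (Bn K n) (Bn K n))

instance : Module (In K n) (Bn K n ⧸ J) := Module.compHom _ (toBn K n)

instance : Module K (Bn K n ⧸ J) :=
  Module.compHom _ ((toBn K n).comp (algebraMap K (In K n)))

instance : IsScalarTower K (In K n) (Bn K n ⧸ J) := by
  constructor
  intro c a v
  show toBn K n (c • a) • v = (toBn K n (algebraMap K (In K n) c)) • (toBn K n a • v)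
  rw [Algebra.smul_def, map_mul, mul_smul]

end BnQuot

/-- The `𝕀_n`-module `M` "is" the tensor product `A ⊗ B` of an `𝕀_m`-module `A` and an
`𝕀_{n-m}`-module `B`: there is a `K`-linear isomorphism under which the generators of `𝕀_n`
with index `< m` act on the first factor (via the corresponding generators of `𝕀_m`) and the
remaining generators act on the second factor (via the generators of `𝕀_{n-m}`). -/
def RealizesSplit (m : ℕ) (A : Type*) [AddCommGroup A] [Module K A] [Module (In K m) A]
    [IsScalarTower K (In K m) A]
    (B : Type*) [AddCommGroup B] [Module K B] [Module (In K (n - m)) B]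
    [IsScalarTower K (In K (n - m)) B]
    (M : Type*) [AddCommGroup M] [Module K M] [Module (In K n) M]
    [IsScalarTower K (In K n) M] : Prop :=
  ∃ φ : M ≃ₗ[K] A ⊗[K] B,
    (∀ (i : Fin n) (hi : (i : ℕ) < m) (v : M),
      φ (xEl K n i • v) = LinearMap.rTensor B
        (DistribMulAction.toLinearMap K A (xEl K m ⟨i, hi⟩)) (φ v) ∧
      φ (dEl K n i • v) = LinearMap.rTensor B
        (DistribMulAction.toLinearMap K A (dEl K m ⟨i, hi⟩)) (φ v) ∧
      φ (intEl K n i • v) = LinearMap.rTensor B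
        (DistribMulAction.toLinearMap K A (intEl K m ⟨i, hi⟩)) (φ v)) ∧
    (∀ (i : Fin n) (hi : m ≤ (i : ℕ)) (v : M),
      φ (xEl K n i • v) = LinearMap.lTensor A
        (DistribMulAction.toLinearMap K B (xEl K (n - m) ⟨(i : ℕ) - m, by omega⟩)) (φ v) ∧
      φ (dEl K n i • v) = LinearMap.lTensor A
        (DistribMulAction.toLinearMap K B (dEl K (n - m) ⟨(i : ℕ) - m, by omega⟩)) (φ v) ∧
      φ (intEl K n i • v) = LinearMap.lTensor A
        (DistribMulAction.toLinearMap K B (intEl K (n - m) ⟨(i : ℕ) - m, by omega⟩)) (φ v))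

end


noncomputable section PartA
variable (K : Type*) [Field K] [CharZero K] (n : ℕ)

lemma ext_mon {a b : In K n} (h : ∀ α : Fin n →₀ ℕ,
    a • (MvPolynomial.monomial α 1 : P K n) = b • (MvPolynomial.monomial α 1 : P K n)) : a = b := by
  have : (show InSub K n from a) = (show InSub K n from b) := by
    apply Subtype.ext
    apply (MvPolynomial.basisMonomials (Fin n) K).ext
    intro α
    rw [MvPolynomial.coe_basisMonomials]
    exact h α
  exact this

lemma In_induction {p : In K n → Prop} (hK : ∀ c : K, p (algebraMap K (In K n) c))
    (hx : ∀ i, p (xEl K n i)) (hd : ∀ i, p (dEl K n i)) (hi : ∀ i, p (intEl K n i))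
    (hadd : ∀ a b, p a → p b → p (a + b)) (hmul : ∀ a b, p a → p b → p (a * b)) (a : In K n) :
    p a := by
  obtain ⟨a, ha⟩ := (show InSub K n from a)
  refine Algebra.adjoin_induction (p := fun (x : Module.End K (P K n)) (hx : x ∈ InSub K n) =>
    p (show In K n from (⟨x, hx⟩ : InSub K n))) ?_ ?_ ?_ ?_ ha
  · rintro _ ((⟨i, rfl⟩ | ⟨i, rfl⟩) | ⟨i, rfl⟩)
    · exact hx i
    · exact hd i
    · exact hi i
  · intro c; exact hK c
  · intro x y h1 h2 h3 h4; exact hadd _ _ h3 h4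
  · intro x y h1 h2 h3 h4; exact hmul _ _ h3 h4

lemma int_mon (i : Fin n) (α : Fin n →₀ ℕ) :
    intEl K n i • (MvPolynomial.monomial α 1 : P K n)
      = (((α i : ℕ) : K) + 1)⁻¹ • MvPolynomial.monomial (α + Finsupp.single i 1) 1 := by
  have := (MvPolynomial.basisMonomials (Fin n) K).constr_basis K
    (fun α => (((α i : ℕ) : K) + 1)⁻¹ •
      (MvPolynomial.monomial (α + Finsupp.single i 1) (1 : K))) α
  rw [MvPolynomial.coe_basisMonomials] at this
  exact this

lemma d_mon (i : Fin n) (α : Fin n →₀ ℕ) :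
    dEl K n i • (MvPolynomial.monomial α 1 : P K n)
      = ((α i : ℕ) : K) • MvPolynomial.monomial (α - Finsupp.single i 1) 1 := by
  rw [dEl_smul, MvPolynomial.pderiv_monomial, MvPolynomial.smul_monomial]
  congr 1
  simp

lemma x_mon (i : Fin n) (α : Fin n →₀ ℕ) :
    xEl K n i • (MvPolynomial.monomial α 1 : P K n)
      = MvPolynomial.monomial (α + Finsupp.single i 1) 1 := by
  rw [xEl_smul, MvPolynomial.X, MvPolynomial.monomial_mul, one_mul, add_comm]

lemma smulK_comm {M : Type*} [AddCommGroup M] [Module K M] [Module (In K n) M]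
    [IsScalarTower K (In K n) M] (a : In K n) (c : K) (m : M) : a • (c • m) = c • (a • m) :=
  (smul_comm c a m).symm

lemma cast1_ne (k : ℕ) : ((k : K) + 1) ≠ 0 := by exact_mod_cast Nat.succ_ne_zero k

lemma d_int (i : Fin n) : dEl K n i * intEl K n i = 1 := by
  apply ext_mon
  intro α
  rw [mul_smul, int_mon, smulK_comm, d_mon, smul_smul, one_smul, add_tsub_cancel_right]
  have := cast1_ne K (α i)
  simp [this]

lemma x_eq (i : Fin n) : xEl K n i = intEl K n i * HEl K n i := by
  apply ext_mon
  intro α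
  rw [mul_smul, hEl_monomial, smulK_comm, int_mon, smul_smul, x_mon,
    mul_inv_cancel₀ (cast1_ne K _), one_smul]

lemma int_comm (i j : Fin n) : intEl K n i * intEl K n j = intEl K n j * intEl K n i := by
  apply ext_mon
  intro α
  rw [mul_smul, mul_smul, int_mon, int_mon, smulK_comm, smulK_comm, int_mon, int_mon, smul_smul,
    smul_smul, add_right_comm]
  by_cases h : i = j
  · subst h; rfl
  · congr 1
    simp [h, Ne.symm h, mul_comm]

lemma H_int (i j : Fin n) : HEl K n i * intEl K n j
    = intEl K n j * (HEl K n i + algebraMap K (In K n) (((Pi.single j 1 : Fin n → ℤ) i : ℤ) : K)) := by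
  apply ext_mon
  intro α
  rw [mul_smul, mul_smul, int_mon, smulK_comm, hEl_monomial, add_smul (HEl K n i), algebraMap_smul,
    hEl_monomial, ← add_smul, smulK_comm, int_mon, smul_comm]
  congr 1
  by_cases h : i = j
  · subst h; simp
  · simp [h]

/-- span of large monomials -/
def WW (N : ℕ) : Submodule K (P K n) :=
  Submodule.span K {p | ∃ α : Fin n →₀ ℕ, (∀ i, N ≤ α i) ∧ p = MvPolynomial.monomial α 1}

lemma WW_anti {N N' : ℕ} (h : N ≤ N') : WW K n N' ≤ WW K n N :=
  Submodule.span_mono (by rintro _ ⟨α, h1, rfl⟩; exact ⟨α, fun i => h.trans (h1 i), rfl⟩)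

lemma WW_le {N : ℕ} {a : In K n} {S : Submodule K (P K n)}
    (h : ∀ α : Fin n →₀ ℕ, (∀ i, N ≤ α i) → a • (MvPolynomial.monomial α 1 : P K n) ∈ S)
    {p : P K n} (hp : p ∈ WW K n N) : a • p ∈ S := by
  induction hp using Submodule.span_induction with
  | mem x h' => obtain ⟨α, h1, rfl⟩ := h'; exact h α h1
  | zero => rw [smul_zero]; exact S.zero_mem
  | add x y _ _ h1 h2 => rw [smul_add]; exact S.add_mem h1 h2
  | smul c x _ h1 => rw [smulK_comm]; exact S.smul_mem c h1

lemma WW_shift (b : In K n) : ∃ k, ∀ N, ∀ p ∈ WW K n (N + k), b • p ∈ WW K n N := by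
  induction b using In_induction with
  | hK c =>
    refine ⟨0, fun N p hp => ?_⟩
    rw [algebraMap_smul]; exact Submodule.smul_mem _ c hp
  | hx i =>
    refine ⟨0, fun N p hp => WW_le K n (fun α hα => ?_) hp⟩
    rw [x_mon]
    exact Submodule.subset_span ⟨_, fun j => (hα j).trans (by simp), rfl⟩
  | hi i =>
    refine ⟨0, fun N p hp => WW_le K n (fun α hα => ?_) hp⟩
    rw [int_mon]
    exact Submodule.smul_mem _ _ (Submodule.subset_span ⟨_, fun j => (hα j).trans (by simp), rfl⟩)
  | hd i =>
    refine ⟨1, fun N p hp => WW_le K n (fun α hα => ?_) hp⟩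
    rw [d_mon]
    refine Submodule.smul_mem _ _ (Submodule.subset_span ⟨_, fun j => ?_, rfl⟩)
    have := hα j
    by_cases h : i = j
    · subst h; simp; omega
    · simp [Ne.symm h]; omega
  | hadd a b ha hb =>
    obtain ⟨k, hk⟩ := ha
    obtain ⟨l, hl⟩ := hb
    refine ⟨k + l, fun N p hp => ?_⟩
    rw [add_smul]
    exact Submodule.add_mem _ (hk N p (WW_anti K n (by omega) hp))
      (hl N p (WW_anti K n (by omega) hp))
  | hmul a b ha hb =>
    obtain ⟨k, hk⟩ := ha
    obtain ⟨l, hl⟩ := hb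
    refine ⟨k + l, fun N p hp => ?_⟩
    rw [mul_smul]
    exact hk _ _ (hl _ _ (by rwa [add_assoc]))

/-- The ideal of operators killing large monomials. -/
def JJ : TwoSidedIdeal (In K n) :=
  TwoSidedIdeal.mk' {a | ∃ N, ∀ p ∈ WW K n N, a • p = 0}
    ⟨0, fun p _ => zero_smul _ _⟩
    (by
      rintro x y ⟨N, hN⟩ ⟨N', hN'⟩
      refine ⟨N + N', fun p hp => ?_⟩
      rw [add_smul, hN p (WW_anti K n (by omega) hp), hN' p (WW_anti K n (by omega) hp), add_zero])
    (by
      rintro x ⟨N, hN⟩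
      exact ⟨N, fun p hp => by rw [neg_smul, hN p hp, neg_zero]⟩)
    (by
      rintro x y ⟨N, hN⟩
      exact ⟨N, fun p hp => by rw [mul_smul, hN p hp, smul_zero]⟩)
    (by
      rintro x y ⟨N, hN⟩
      obtain ⟨k, hk⟩ := WW_shift K n y
      exact ⟨N + k, fun p hp => by rw [mul_smul, hN _ (hk _ p hp)]⟩)

lemma mem_JJ (a : In K n) : a ∈ JJ K n ↔ ∃ N, ∀ p ∈ WW K n N, a • p = 0 :=
  TwoSidedIdeal.mem_mk' _ _ _ _ _ _ _

lemma e_eq (i : Fin n) (s t : ℕ) :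
    eElN K n i s t = intEl K n i ^ s * (1 - intEl K n i * dEl K n i) * dEl K n i ^ t := by
  rw [eElN, mul_sub, mul_one, sub_mul, pow_succ, pow_succ' (dEl K n i)]
  simp only [mul_assoc]

lemma aFull_le {I : TwoSidedIdeal (In K n)} (h : ∀ i, 1 - intEl K n i * dEl K n i ∈ I) :
    aFull K n ≤ I := by
  refine iSup₂_le fun i _ => ?_
  refine TwoSidedIdeal.span_le.2 ?_
  rintro _ ⟨s, t, rfl⟩
  rw [e_eq]
  exact I.mul_mem_right _ _ (I.mul_mem_left _ _ (h i))

lemma e00_mem (i : Fin n) : 1 - intEl K n i * dEl K n i ∈ aFull K n := by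
  have h1 : pIdeal K n i ≤ aFull K n := le_iSup₂_of_le i (Set.mem_univ i) le_rfl
  apply h1
  apply TwoSidedIdeal.subset_span
  refine ⟨0, 0, ?_⟩
  rw [e_eq]; simp

lemma toBn_eq_zero (a : In K n) : toBn K n a = 0 ↔ a ∈ aFull K n := by
  rw [← TwoSidedIdeal.mem_ker, toBn]
  show a ∈ TwoSidedIdeal.ker (aFull K n).ringCon.mk' ↔ _
  rw [TwoSidedIdeal.ker_ringCon_mk']

lemma aFull_le_JJ : aFull K n ≤ JJ K n := by
  apply aFull_le
  intro i
  rw [mem_JJ]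
  refine ⟨1, fun p hp => ?_⟩
  have := WW_le K n (S := ⊥) (a := 1 - intEl K n i * dEl K n i) (fun α hα => ?_) hp
  · exact this
  · rw [Submodule.mem_bot, sub_smul, one_smul, mul_smul, d_mon, smulK_comm, int_mon, smul_smul]
    have h1 := hα i
    have h2 : α - Finsupp.single i 1 + Finsupp.single i 1 = α := by
      apply tsub_add_cancel_of_le
      simpa using h1
    rw [h2]
    have h3 : (((α - Finsupp.single i 1 : Fin n →₀ ℕ) i : ℕ) : K) + 1 = (α i : K) := by
      simp [Nat.cast_sub h1]
    rw [h3, mul_inv_cancel₀, one_smul, sub_self]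
    exact_mod_cast (by omega)

/-- polynomials to D_n -/
def dnP : MvPolynomial (Fin n) K →ₐ[K] Dn K n := MvPolynomial.aeval (HElD K n)

lemma dnVal_HElD (i : Fin n) : dnVal K n (HElD K n i) = HEl K n i := rfl

lemma dnP_surj : Function.Surjective (dnP K n) := by
  have key : ∀ (x : In K n) (hx : x ∈ DnSub K n), ∃ q, dnVal K n (dnP K n q) = x := by
    intro x hx
    induction hx using Algebra.adjoin_induction with
    | mem x hx =>
      obtain ⟨i, rfl⟩ := hx
      exact ⟨MvPolynomial.X i, by rw [dnP, MvPolynomial.aeval_X, dnVal_HElD]⟩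
    | algebraMap c => exact ⟨MvPolynomial.C c, by
        rw [← MvPolynomial.algebraMap_eq, AlgHom.commutes, dnVal_algebraMap]⟩
    | add x y _ _ h1 h2 =>
      obtain ⟨p, rfl⟩ := h1
      obtain ⟨q, rfl⟩ := h2
      exact ⟨p + q, by rw [map_add, map_add]⟩
    | mul x y _ _ h1 h2 =>
      obtain ⟨p, rfl⟩ := h1
      obtain ⟨q, rfl⟩ := h2
      exact ⟨p * q, by rw [map_mul, map_mul]⟩
  intro d
  obtain ⟨q, hq⟩ := key (dnVal K n d) (show DnSub K n from d).2
  exact ⟨q, Subtype.ext hq⟩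

lemma dnP_smul (q : MvPolynomial (Fin n) K) (α : Fin n →₀ ℕ) :
    dnVal K n (dnP K n q) • (MvPolynomial.monomial α 1 : P K n)
      = MvPolynomial.eval (fun i => ((α i : ℕ) : K) + 1) q • MvPolynomial.monomial α 1 := by
  induction q using MvPolynomial.induction_on with
  | C c => rw [← MvPolynomial.algebraMap_eq, AlgHom.commutes, dnVal_algebraMap, algebraMap_smul,
      MvPolynomial.algebraMap_eq, MvPolynomial.eval_C]
  | add p q h1 h2 => rw [map_add, map_add, add_smul, h1, h2, map_add, add_smul]
  | mul_X p i h => 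
    rw [map_mul, map_mul, mul_smul, map_mul, dnP, MvPolynomial.aeval_X, dnVal_HElD, hEl_monomial,
      smulK_comm, ← dnP, h, smul_smul, MvPolynomial.eval_X, mul_comm]

lemma poly_zero (q : MvPolynomial (Fin n) K) (h : toBn K n (dnVal K n (dnP K n q)) = 0) :
    q = 0 := by
  rw [toBn_eq_zero] at h
  obtain ⟨N, hN⟩ := (mem_JJ K n _).1 (aFull_le_JJ K n h)
  refine MvPolynomial.funext_set (fun _ => {c : K | ∃ k : ℕ, N ≤ k ∧ c = (k : K) + 1}) (fun i => ?_) ?_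
  · refine Set.infinite_of_injective_forall_mem (f := fun k : ℕ => ((N + k : ℕ) : K) + 1) ?_ ?_
    · intro a b hab; simpa using hab
    · intro k; exact ⟨N + k, by omega, rfl⟩
  · intro x hx
    choose k hk1 hk2 using fun i => hx i (Set.mem_univ i)
    have := hN (MvPolynomial.monomial (Finsupp.equivFunOnFinite.symm k) 1)
      (Submodule.subset_span ⟨_, hk1, rfl⟩)
    rw [dnP_smul] at this
    rw [map_zero]
    have h2 : x = fun i => (((Finsupp.equivFunOnFinite.symm k : Fin n →₀ ℕ) i : ℕ) : K) + 1 := by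
      funext i; rw [hk2 i]; rfl
    rw [h2]
    rcases smul_eq_zero.1 this with h | h
    · exact h
    · simp at h

lemma bnD_inj : Function.Injective (bnD K n) := by
  rw [injective_iff_map_eq_zero]
  intro d hd
  obtain ⟨q, rfl⟩ := dnP_surj K n d
  rw [poly_zero K n q hd, map_zero]

lemma dnP_inj : Function.Injective (dnP K n) := by
  rw [injective_iff_map_eq_zero]
  intro q hq
  apply poly_zero
  rw [hq, map_zero, map_zero]

lemma exists_ev (mu : Fin n → K) : ∃ ev : Dn K n →ₐ[K] K, ∀ i, ev (HElD K n i) = mu i := by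
  let e := AlgEquiv.ofBijective (dnP K n) ⟨dnP_inj K n, dnP_surj K n⟩
  refine ⟨(MvPolynomial.aeval mu).comp e.symm.toAlgHom, fun i => ?_⟩
  have : e (MvPolynomial.X i) = HElD K n i := by
    show dnP K n _ = _
    rw [dnP, MvPolynomial.aeval_X]
  rw [← this]
  simp

end PartA

noncomputable section PartB
variable (K : Type*) [Field K] [CharZero K] (n : ℕ)

lemma toBn_int_d (i : Fin n) : toBn K n (intEl K n i) * toBn K n (dEl K n i) = 1 := by
  have := (toBn_eq_zero K n _).2 (e00_mem K n i)
  rw [map_sub, map_one, map_mul] at this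
  exact (sub_eq_zero.1 this).symm

lemma toBn_d_int (i : Fin n) : toBn K n (dEl K n i) * toBn K n (intEl K n i) = 1 := by
  rw [← map_mul, d_int, map_one]

/-- `∫_i` as a unit of `B_n`. -/
def uu (i : Fin n) : (Bn K n)ˣ :=
  ⟨toBn K n (intEl K n i), toBn K n (dEl K n i), toBn_int_d K n i, toBn_d_int K n i⟩

lemma uu_comm (i j : Fin n) : Commute (uu K n i) (uu K n j) := by
  apply Units.ext
  show toBn K n (intEl K n i) * toBn K n (intEl K n j) = toBn K n (intEl K n j) * toBn K n (intEl K n i)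
  rw [← map_mul, int_comm, map_mul]

/-- the monomials -/
def TT0 : (Fin n → Multiplicative ℤ) →* (Bn K n)ˣ :=
  MonoidHom.noncommPiCoprod (fun i => zpowersHom (Bn K n)ˣ (uu K n i)) (by
    intro i j _ x y
    simp only [zpowersHom_apply]
    exact ((uu_comm K n i j).zpow_left _).zpow_right _)

/-- the monomials -/
def TT (z : Fin n → ℤ) : (Bn K n)ˣ := TT0 K n (fun i => Multiplicative.ofAdd (z i))

lemma TT_add (z w : Fin n → ℤ) : TT K n (z + w) = TT K n z * TT K n w := by
  rw [TT, TT, TT, ← map_mul]; rfl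

lemma TT_zero : TT K n 0 = 1 := by
  rw [TT]; exact map_one (TT0 K n)

lemma TT_neg (z : Fin n → ℤ) : TT K n (-z) = (TT K n z)⁻¹ := by
  rw [eq_inv_iff_mul_eq_one, ← TT_add, neg_add_cancel, TT_zero]

lemma TT_single (i : Fin n) : TT K n (Pi.single i 1) = uu K n i := by
  have : (fun j => Multiplicative.ofAdd ((Pi.single i 1 : Fin n → ℤ) j))
    = Pi.mulSingle i (Multiplicative.ofAdd (1 : ℤ)) := by
    funext j
    by_cases h : j = i
    · subst h; simp
    · simp [h]
  rw [TT, this]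
  refine (MonoidHom.noncommPiCoprod_mulSingle _ i _).trans ?_
  simp

lemma pi_ind {p : (Fin n → ℤ) → Prop} (h0 : p 0) (hadd : ∀ z w, p z → p w → p (z + w))
    (hneg : ∀ z, p z → p (-z)) (h1 : ∀ i, p (Pi.single i 1)) (z : Fin n → ℤ) : p z := by
  rw [← Finset.univ_sum_single z]
  apply Finset.sum_induction _ p hadd h0
  intro i _
  let S : AddSubgroup (Fin n → ℤ) :=
    { carrier := {z | p z}, add_mem' := fun {a b} ha hb => hadd a b ha hb, zero_mem' := h0,
      neg_mem' := fun {a} ha => hneg a ha }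
  have : z i • (Pi.single i (1 : ℤ) : Fin n → ℤ) ∈ S := S.zsmul_mem (h1 i) _
  have h2 : z i • (Pi.single i (1 : ℤ) : Fin n → ℤ) = Pi.single i (z i) := by
    rw [← Pi.single_smul]; simp
  rw [h2] at this
  exact this

/-- scalars in B_n -/
def kk : K →+* Bn K n := (toBn K n).comp (algebraMap K (In K n))

lemma kk_comm (c : K) (u : Bn K n) : kk K n c * u = u * kk K n c := bn_algebraMap_comm K n c u

lemma bnD_algebraMap (c : K) : bnD K n (algebraMap K (Dn K n) c) = kk K n c := by
  show toBn K n (dnVal K n _) = _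
  rw [dnVal_algebraMap]; rfl

lemma bnD_H (i : Fin n) : bnD K n (HElD K n i) = toBn K n (HEl K n i) := rfl

lemma H_TT (z : Fin n → ℤ) (i : Fin n) :
    toBn K n (HEl K n i) * (TT K n z : Bn K n)
      = TT K n z * (toBn K n (HEl K n i) + kk K n ((z i : ℤ) : K)) := by
  revert i
  induction z using pi_ind with
  | h0 => intro i; simp [TT_zero]
  | hadd z w hz hw =>
    intro i
    rw [TT_add, Units.val_mul, ← mul_assoc, hz, mul_assoc, add_mul, hw, kk_comm, mul_assoc,
      ← mul_add]
    congr 2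
    simp; abel
  | hneg z hz =>
    intro i
    rw [TT_neg]
    have := hz i
    have e : (TT K n z : Bn K n) * toBn K n (HEl K n i)
        = (toBn K n (HEl K n i) - kk K n ((z i : ℤ) : K)) * TT K n z := by
      rw [sub_mul, this, mul_add, kk_comm]; abel
    rw [Units.eq_inv_mul_iff_mul_eq, ← mul_assoc, e, Units.mul_inv_cancel_right]
    simp [sub_eq_add_neg]
  | h1 j =>
    intro i
    rw [TT_single]
    show toBn K n _ * toBn K n (intEl K n j) = toBn K n (intEl K n j) * _
    rw [← map_mul, H_int, map_mul, map_add]; rfl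

lemma smul_def_Bn (d : Dn K n) (b : Bn K n) : d • b = b * bnD K n d := rfl

lemma span_TT : Submodule.span (Dn K n) (Set.range fun z => (TT K n z : Bn K n)) = ⊤ := by
  set S := Submodule.span (Dn K n) (Set.range fun z => (TT K n z : Bn K n)) with hS
  have hred : ∀ b : Bn K n, (∀ z, b * TT K n z ∈ S) → ∀ s ∈ S, b * s ∈ S := by
    intro b hb s hs
    induction hs using Submodule.span_induction with
    | mem x h => obtain ⟨z, rfl⟩ := h; exact hb z
    | zero => rw [mul_zero]; exact S.zero_mem
    | add x y _ _ h1 h2 => rw [mul_add]; exact S.add_mem h1 h2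
    | smul d x _ h =>
      have : b * (d • x) = d • (b * x) := (smul_comm d b x).symm
      rw [this]; exact S.smul_mem d h
  have key : ∀ a : In K n, ∀ s ∈ S, toBn K n a * s ∈ S := by
    intro a
    have hTm : ∀ z, (TT K n z : Bn K n) ∈ S := fun z => Submodule.subset_span ⟨z, rfl⟩
    have hint : ∀ i, ∀ s ∈ S, toBn K n (intEl K n i) * s ∈ S := by
      intro i
      apply hred
      intro z
      have : toBn K n (intEl K n i) * TT K n z = TT K n (Pi.single i 1 + z) := by
        rw [TT_add, TT_single]; rfl
      rw [this]; exact hTm _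
    induction a using In_induction with
    | hK c =>
      apply hred
      intro z
      have : toBn K n (algebraMap K (In K n) c) * TT K n z = algebraMap K (Dn K n) c • (TT K n z : Bn K n) := by
        rw [smul_def_Bn, bnD_algebraMap, ← kk_comm]; rfl
      rw [this]; exact S.smul_mem _ (hTm z)
    | hx i =>
      intro s hs
      rw [x_eq, map_mul, mul_assoc]
      apply hint
      revert s
      apply hred
      intro z
      rw [H_TT, ← bnD_H, ← bnD_algebraMap, ← map_add, ← smul_def_Bn]
      exact S.smul_mem _ (hTm z)
    | hd i =>
      apply hred
      intro z
      have : toBn K n (dEl K n i) * TT K n z = TT K n (-Pi.single i 1 + z) := by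
        rw [TT_add, TT_neg, TT_single]; rfl
      rw [this]; exact hTm _
    | hi i => exact hint i
    | hadd a b ha hb => intro s hs; rw [map_add, add_mul]; exact S.add_mem (ha s hs) (hb s hs)
    | hmul a b ha hb => intro s hs; rw [map_mul, mul_assoc]; exact ha _ (hb _ hs)
  rw [eq_top_iff]
  intro b _
  obtain ⟨a, rfl⟩ := toBn_surjective K n b
  have := key a 1 (Submodule.subset_span ⟨0, by simp [TT_zero]⟩)
  rwa [mul_one] at this

lemma indep_gen {ι V : Type*} [AddCommGroup V] [Module K V] (f : ι → Module.End K V)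
    (h : ∀ i j, Commute (f i) (f j)) :
    iSupIndep fun χ : ι → K => ⨅ i, (f i).maxGenEigenspace (χ i) :=
  Module.End.independent_iInf_maxGenEigenspace_of_forall_mapsTo f fun i j φ =>
    Module.End.mapsTo_maxGenEigenspace_of_comm (h j i) φ

lemma exists_pi : ∃ π : Bn K n →ₗ[Dn K n] Dn K n, π 1 = 1 := by
  let f : Dn K n →ₗ[Dn K n] Bn K n := LinearMap.toSpanSingleton (Dn K n) (Bn K n) 1
  have hfd : ∀ d, f d = bnD K n d := fun d => by
    rw [LinearMap.toSpanSingleton_apply, smul_def_Bn, one_mul]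
  have hf : Function.Injective f := by
    intro a b hab
    rw [hfd, hfd] at hab
    exact bnD_inj K n hab
  let C' := Submodule.span (Dn K n) ((fun z => (TT K n z : Bn K n)) '' {z | z ≠ 0})
  let _ : Algebra K (Bn K n) := (kk K n).toAlgebra' (kk_comm K n)
  let ad : Fin n → Module.End K (Bn K n) := fun i =>
    LinearMap.mulLeft K (toBn K n (HEl K n i)) - LinearMap.mulRight K (toBn K n (HEl K n i))
  have had : ∀ i b, ad i b = toBn K n (HEl K n i) * b - b * toBn K n (HEl K n i) := fun i b => rfl
  have hcomm : ∀ i j, Commute (ad i) (ad j) := by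
    intro i j
    apply LinearMap.ext
    intro b
    have hH : toBn K n (HEl K n i) * toBn K n (HEl K n j)
      = toBn K n (HEl K n j) * toBn K n (HEl K n i) := by
      rw [← map_mul, hEl_comm, map_mul]
    show ad i (ad j b) = ad j (ad i b)
    simp only [had, mul_sub, sub_mul]
    rw [← mul_assoc, ← mul_assoc, hH, mul_assoc b, mul_assoc b, hH]
    simp only [mul_assoc]
    abel
  have hind := indep_gen K ad hcomm
  have hmem : ∀ (z : Fin n → ℤ) (d : Dn K n), (d • (TT K n z : Bn K n)) ∈
      ⨅ i, (ad i).maxGenEigenspace ((fun i => ((z i : ℤ) : K)) i) := by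
    intro z d
    rw [Submodule.mem_iInf]
    intro i
    apply (Module.End.genEigenspace _ _).mono (le_top (a := (1 : ℕ∞)))
    rw [Module.End.mem_genEigenspace_one, had, smul_def_Bn, ← mul_assoc, H_TT, mul_assoc, add_mul,
      mul_assoc _ (bnD K n d)]
    have hH : toBn K n (HEl K n i) * bnD K n d = bnD K n d * toBn K n (HEl K n i) := by
      rw [← bnD_H, ← map_mul, mul_comm, map_mul]
    rw [hH, mul_add, add_sub_cancel_left, ← mul_assoc, ← kk_comm, mul_assoc]
    rfl
  have hcompl : IsCompl (LinearMap.range f) C' := by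
    constructor
    · rw [Submodule.disjoint_def]
      rintro x ⟨d, rfl⟩ hx
      have h0 : f d ∈ ⨅ i, (ad i).maxGenEigenspace ((0 : Fin n → K) i) := by
        have := hmem 0 d
        rw [TT_zero] at this
        simpa [hfd, smul_def_Bn] using this
      refine Submodule.disjoint_def.1 (hind 0) _ h0 ?_
      generalize f d = x at hx
      induction hx using Submodule.closure_induction with
      | zero => exact Submodule.zero_mem _
      | add x y _ _ h1 h2 => exact Submodule.add_mem _ h1 h2
      | smul_mem r x hx =>
        obtain ⟨z, hz, rfl⟩ := hx
        have hne : (fun i => ((z i : ℤ) : K)) ≠ 0 := by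
          intro h
          apply hz
          funext i
          simpa using congrFun h i
        exact (le_iSup₂_of_le (f := fun (χ : Fin n → K) (_ : χ ≠ 0) =>
          ⨅ i, (ad i).maxGenEigenspace (χ i)) _ hne le_rfl) (hmem z r)
    · rw [codisjoint_iff, eq_top_iff, ← span_TT, Submodule.span_le]
      rintro _ ⟨z, rfl⟩
      by_cases hz : z = 0
      · subst hz
        apply Submodule.mem_sup_left
        exact ⟨1, by rw [hfd, map_one]; simp [TT_zero]⟩
      · exact Submodule.mem_sup_right (Submodule.subset_span ⟨z, hz, rfl⟩)
  refine ⟨(LinearEquiv.ofInjective f hf).symm.toLinearMap ∘ₗ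
    Submodule.projectionOnto _ _ hcompl, ?_⟩
  have h1 : (1 : Bn K n) = ((LinearEquiv.ofInjective f hf 1 : LinearMap.range f) : Bn K n) := by
    rw [LinearEquiv.ofInjective_apply, hfd, map_one]
  rw [h1, LinearMap.comp_apply, Submodule.projectionOnto_apply_left]
  simp

end PartB

noncomputable section PartC
variable (K : Type*) [Field K] [CharZero K] (n : ℕ)

/-- modules killed by `𝔞_n` -/
def Kil (M : Type*) [AddCommGroup M] [Module (In K n) M] : Prop :=
  ∀ a : In K n, toBn K n a = 0 → ∀ m : M, a • m = 0

/-- lift of the monomial -/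
def tl (z : Fin n → ℤ) : In K n := (toBn_surjective K n (TT K n z)).choose

lemma tl_spec (z : Fin n → ℤ) : toBn K n (tl K n z) = TT K n z :=
  (toBn_surjective K n (TT K n z)).choose_spec

/-- the cast -/
def zc (z : Fin n → ℤ) : Fin n → K := fun i => ((z i : ℤ) : K)

section kil
variable {M : Type*} [AddCommGroup M] [Module (In K n) M]

lemma kil_eq (h : Kil K n M) {a b : In K n} (hab : toBn K n a = toBn K n b) (m : M) :
    a • m = b • m := by
  rw [← sub_eq_zero, ← sub_smul]
  exact h _ (by rw [map_sub, hab, sub_self]) m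

lemma kil_of (h : ∀ i (m : M), intEl K n i • dEl K n i • m = m) : Kil K n M := by
  have hle : aFull K n ≤ TwoSidedIdeal.ker (Module.toAddMonoidEnd (In K n) M) := by
    apply aFull_le
    intro i
    rw [TwoSidedIdeal.mem_ker]
    ext m
    show (1 - intEl K n i * dEl K n i) • m = 0
    rw [sub_smul, one_smul, mul_smul, h, sub_self]
  intro a ha m
  have := hle ((toBn_eq_zero K n a).1 ha)
  rw [TwoSidedIdeal.mem_ker] at this
  exact DFunLike.congr_fun this m

lemma kil_int_d (h : Kil K n M) (i : Fin n) (m : M) : intEl K n i • dEl K n i • m = m := by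
  rw [← mul_smul, kil_eq K n h (b := 1), one_smul]
  rw [map_mul, toBn_int_d, map_one]

lemma tl_add (h : Kil K n M) (z w : Fin n → ℤ) (m : M) :
    tl K n z • tl K n w • m = tl K n (z + w) • m := by
  rw [← mul_smul]
  apply kil_eq K n h
  rw [map_mul, tl_spec, tl_spec, tl_spec, TT_add, Units.val_mul]

lemma tl_zero (h : Kil K n M) (m : M) : tl K n 0 • m = m := by
  rw [kil_eq K n h (b := 1), one_smul]
  rw [tl_spec, TT_zero, map_one, Units.val_one]

lemma int_tl (h : Kil K n M) (i : Fin n) (m : M) :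
    intEl K n i • m = tl K n (Pi.single i 1) • m := by
  apply kil_eq K n h
  rw [tl_spec, TT_single]; rfl

lemma d_tl (h : Kil K n M) (i : Fin n) (m : M) :
    dEl K n i • m = tl K n (-Pi.single i 1) • m := by
  apply kil_eq K n h
  rw [tl_spec, TT_neg, TT_single]; rfl

lemma H_tl (h : Kil K n M) (z : Fin n → ℤ) (i : Fin n) (c : K) (N : ℕ) (m : M) :
    (HEl K n i - algebraMap K (In K n) (c + (z i : ℤ))) ^ N • tl K n z • m
      = tl K n z • (HEl K n i - algebraMap K (In K n) c) ^ N • m := by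
  rw [← mul_smul, ← mul_smul]
  apply kil_eq K n h
  rw [map_mul, map_mul, tl_spec, map_pow, map_pow]
  have : SemiconjBy (TT K n z : Bn K n) (toBn K n (HEl K n i - algebraMap K (In K n) c))
      (toBn K n (HEl K n i - algebraMap K (In K n) (c + (z i : ℤ)))) := by
    show _ * _ = _ * _
    rw [map_sub, map_sub, sub_mul, H_TT]
    show _ * (_ - kk K n c) = _ - kk K n _ * _
    rw [kk_comm, ← mul_sub, map_add]
    congr 1
    abel
  exact (this.pow_right N).eq.symm

lemma kil_sub (h : Kil K n M) (p : Submodule (In K n) M) : Kil K n p :=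
  fun a ha m => Subtype.ext (h a ha m)

lemma kil_quot (h : Kil K n M) (p : Submodule (In K n) M) : Kil K n (M ⧸ p) := by
  intro a ha m
  induction m using Submodule.Quotient.induction_on with
  | H m => rw [← Submodule.Quotient.mk_smul, h a ha, Submodule.Quotient.mk_zero]

lemma kil_equiv {M' : Type*} [AddCommGroup M'] [Module (In K n) M'] (e : M ≃ₗ[In K n] M')
    (h : Kil K n M') : Kil K n M := fun a ha m => e.injective (by
  rw [map_smul, h a ha, map_zero])

end kil

section wt
variable {M : Type*} [AddCommGroup M] [Module K M] [Module (In K n) M]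
  [IsScalarTower K (In K n) M]

lemma mem_gws (mu : Fin n → K) (m : M) : m ∈ genWeightSpace K n M mu ↔ ∃ N : ℕ, ∀ i,
    ((HEl K n i - algebraMap K (In K n) (mu i)) ^ N) • m = 0 := Iff.rfl

lemma tl_mem (h : Kil K n M) (z : Fin n → ℤ) {mu : Fin n → K} {m : M}
    (hm : m ∈ genWeightSpace K n M mu) : tl K n z • m ∈ genWeightSpace K n M (mu + zc K n z) := by
  obtain ⟨N, hN⟩ := hm
  refine ⟨N, fun i => ?_⟩
  have := H_tl K n h z i (mu i) N m
  rw [hN i, smul_zero] at this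
  exact this

lemma gws_indep : iSupIndep fun mu : Fin n → K => genWeightSpace K n M mu := by
  let f : Fin n → Module.End K M := fun i => Algebra.lsmul K K M (HEl K n i)
  have hf : ∀ i j, Commute (f i) (f j) := by
    intro i j
    show _ * _ = _ * _
    rw [← map_mul, hEl_comm, map_mul]
  refine (indep_gen K f hf).mono ?_
  rintro mu m ⟨N, hN⟩
  rw [Submodule.mem_iInf]
  intro i
  rw [Module.End.mem_maxGenEigenspace]
  refine ⟨N, ?_⟩
  have : (f i - mu i • 1) ^ N = Algebra.lsmul K K M ((HEl K n i - algebraMap K (In K n) (mu i)) ^ N) := by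
    rw [map_pow, map_sub, AlgHom.commutes, Algebra.algebraMap_eq_smul_one]
  rw [this]
  exact hN i

lemma gws_of_eig {mu : Fin n → K} {m : M} (h : ∀ i, HEl K n i • m = mu i • m) :
    m ∈ genWeightSpace K n M mu :=
  ⟨1, fun i => by rw [pow_one, sub_smul, h, algebraMap_smul, sub_self]⟩

variable (M) in
/-- spanned by the generalized weight spaces of the orbit -/
def Orb (lam : Fin n → K) : Prop :=
  ⨆ z : Fin n → ℤ, genWeightSpace K n M (lam + zc K n z) = ⊤

lemma orb_iff (lam : Fin n → K) : Orb K n M lam ↔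
    (IsGenWeightModule K n M ∧ supp K n M ⊆ orbitOf K n lam) := by
  letI := Classical.decEq (Fin n → K)
  unfold IsGenWeightModule
  rw [DirectSum.isInternal_submodule_iff_iSupIndep_and_iSup_eq_top]
  constructor
  · intro h
    refine ⟨⟨gws_indep K n, ?_⟩, ?_⟩
    · rw [eq_top_iff, ← h]
      exact iSup_le fun z => le_iSup (fun mu => genWeightSpace K n M mu) _
    · intro mu hmu
      by_contra hc
      apply hmu
      have := gws_indep K n (M := M) mu
      rw [eq_bot_iff]
      refine this le_rfl ?_
      refine le_trans le_top ?_
      rw [← h]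
      refine iSup_le fun z => ?_
      refine le_iSup₂_of_le (f := fun (χ : Fin n → K) (_ : χ ≠ mu) =>
          genWeightSpace K n M χ) (lam + zc K n z) ?_ le_rfl
      rintro rfl
      exact hc fun i => ⟨z i, by simp [zc]⟩
  · rintro ⟨⟨-, h1⟩, h2⟩
    rw [Orb, eq_top_iff, ← h1]
    refine iSup_le fun mu => ?_
    by_cases hmu : genWeightSpace K n M mu = ⊥
    · rw [hmu]; exact bot_le
    · choose z hz using h2 hmu
      have : mu = lam + zc K n z := by
        funext i
        simp [zc, ← hz i]
      rw [this]
      exact le_iSup (fun z => genWeightSpace K n M (lam + zc K n z)) z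

lemma sub_top (h : Kil K n M) {lam : Fin n → K} (ho : Orb K n M lam) (S : Submodule (In K n) M)
    (hS : ∀ m ∈ genWeightSpace K n M lam, m ∈ S) : S = ⊤ := by
  have : (⊤ : Submodule K M) ≤ S.restrictScalars K := by
    rw [← ho]
    refine iSup_le fun z m hm => ?_
    have h1 := tl_mem K n h (-z) hm
    have h2 : lam + zc K n z + zc K n (-z) = lam := by
      funext i; simp [zc]
    rw [h2] at h1
    have h3 := S.smul_mem (tl K n z) (hS _ h1)
    rw [tl_add K n h, add_neg_cancel, tl_zero K n h] at h3
    exact h3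
  exact eq_top_iff.2 fun m _ => this (Submodule.mem_top)

lemma eig_gen {R V ι : Type*} [CommRing R] [AddCommGroup V] [Module R V]
    (h : ι → ℤ → R) (m : V) (hm : m ≠ 0)
    (hz : ∀ i, ∃ l : List ℤ, (l.map (h i)).prod • m = 0) (s : Finset ι) :
    ∃ a : R, ∃ z : ι → ℤ, a • m ≠ 0 ∧ ∀ i ∈ s, h i (z i) • a • m = 0 := by
  classical
  induction s using Finset.induction_on with
  | empty => exact ⟨1, 0, by rwa [one_smul], by simp⟩
  | insert i s his ih =>
    obtain ⟨a, z, ha, hs⟩ := ih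
    obtain ⟨l, hl⟩ := hz i
    have aux : ∀ l : List ℤ, ∀ v : V, v ≠ 0 → (l.map (h i)).prod • v = 0 →
        ∃ b : R, ∃ w : ℤ, b • v ≠ 0 ∧ h i w • b • v = 0 := by
      intro l
      induction l with
      | nil => intro v hv h0; simp at h0; exact absurd h0 hv
      | cons w l ihl =>
        intro v hv h0
        by_cases hc : (l.map (h i)).prod • v = 0
        · exact ihl v hv hc
        · refine ⟨_, w, hc, ?_⟩
          rwa [List.map_cons, List.prod_cons, mul_smul] at h0
    obtain ⟨b, w, hb, hw⟩ := aux l (a • m) ha (by rw [smul_comm, hl, smul_zero])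
    refine ⟨b * a, Function.update z i w, by rwa [mul_smul], ?_⟩
    intro j hj
    rw [mul_smul]
    by_cases hji : j = i
    · subst hji; rwa [Function.update_self]
    · rw [Function.update_of_ne hji, smul_comm _ b, hs j (Finset.mem_of_mem_insert_of_ne hj hji),
        smul_zero]

/-- linear factors -/
def hD (lam : Fin n → K) (i : Fin n) (z : ℤ) : Dn K n :=
  HElD K n i - algebraMap K (Dn K n) (lam i + (z : K))

lemma dnVal_hD (lam : Fin n → K) (i : Fin n) (z : ℤ) :
    dnVal K n (hD K n lam i z) = HEl K n i - algebraMap K (In K n) (lam i + (z : K)) := by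
  rw [hD, map_sub, dnVal_algebraMap, dnVal_HElD]

/-- locally annihilated -/
def ZP (lam : Fin n → K) {M : Type*} [AddCommGroup M] [Module (In K n) M] (m : M) : Prop :=
  ∀ i, ∃ l : List ℤ, dnVal K n ((l.map (hD K n lam i)).prod) • m = 0

lemma zp_of_orb {lam : Fin n → K} (ho : Orb K n M lam) (m : M) : ZP K n lam m := by
  have hm : m ∈ ⨆ z : Fin n → ℤ, genWeightSpace K n M (lam + zc K n z) := by
    rw [ho]; trivial
  induction hm using Submodule.iSup_induction' with
  | mem z m hm =>
    obtain ⟨N, hN⟩ := hm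
    intro i
    refine ⟨List.replicate N (z i), ?_⟩
    rw [List.map_replicate, List.prod_replicate, map_pow, dnVal_hD]
    exact hN i
  | zero => exact fun i => ⟨[], smul_zero _⟩
  | add x y _ _ hx hy =>
    intro i
    obtain ⟨l, hl⟩ := hx i
    obtain ⟨l', hl'⟩ := hy i
    refine ⟨l ++ l', ?_⟩
    rw [List.map_append, List.prod_append, smul_add]
    nth_rw 1 [mul_comm]
    rw [map_mul, map_mul, mul_smul, mul_smul, hl, hl', smul_zero, smul_zero, add_zero]

lemma exists_eig (h : Kil K n M) {lam : Fin n → K} {m : M} (hm : m ≠ 0) (hz : ZP K n lam m) :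
    ∃ a : In K n, a • m ≠ 0 ∧ ∀ i, HEl K n i • a • m = lam i • a • m := by
  let _ := Module.compHom M (dnVal K n)
  obtain ⟨a, z, ha, hs⟩ := eig_gen (hD K n lam) m hm hz Finset.univ
  refine ⟨tl K n (-z) * dnVal K n a, ?_, ?_⟩
  · intro h0
    rw [mul_smul] at h0
    apply ha
    have : tl K n z • tl K n (-z) • dnVal K n a • m = 0 := by rw [h0, smul_zero]
    rwa [tl_add K n h, add_neg_cancel, tl_zero K n h] at this
  · intro i
    have h1 : (HEl K n i - algebraMap K (In K n) (lam i + (z i : K))) • dnVal K n a • m = 0 := by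
      have := hs i (Finset.mem_univ i)
      rw [← dnVal_hD]; exact this
    have := H_tl K n h (-z) i (lam i + (z i : K)) 1 (dnVal K n a • m)
    rw [pow_one, pow_one, h1, smul_zero] at this
    have e : lam i + (z i : K) + (((-z) i : ℤ) : K) = lam i := by simp
    rw [e, sub_smul, sub_eq_zero, algebraMap_smul] at this
    rw [mul_smul]; exact this

end wt

lemma lf_of (lam : Fin n → K) (N : Type*) [AddCommGroup N] [Module K N] [Module (Dn K n) N]
    [IsScalarTower K (Dn K n) N] (x : N) (s : ℕ)
    (hs : ∀ i, ((HElD K n i - algebraMap K (Dn K n) (lam i)) ^ s) • x = 0) :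
    FiniteDimensional K ((Submodule.span (Dn K n) {x}).restrictScalars K) := by
  let I : Ideal (Dn K n) := Ideal.torsionOf (Dn K n) N x
  let f : MvPolynomial (Fin n) K →ₐ[K] (Dn K n ⧸ I) := (Ideal.Quotient.mkₐ K I).comp (dnP K n)
  have hf : Function.Surjective f :=
    (Ideal.Quotient.mkₐ_surjective K I).comp (dnP_surj K n)
  have hH : ∀ i, IsIntegral K (f (MvPolynomial.X i)) := by
    intro i
    have h1 : f (MvPolynomial.X i) = Ideal.Quotient.mkₐ K I (HElD K n i) := by
      show Ideal.Quotient.mkₐ K I (dnP K n _) = _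
      rw [dnP, MvPolynomial.aeval_X]
    have h2 : IsNilpotent (f (MvPolynomial.X i) - algebraMap K _ (lam i)) := by
      refine ⟨s, ?_⟩
      rw [h1, ← AlgHom.commutes (Ideal.Quotient.mkₐ K I), ← map_sub, ← map_pow]
      exact Ideal.Quotient.eq_zero_iff_mem.2 ((Ideal.mem_torsionOf_iff _ _).2 (hs i))
    have h3 : IsIntegral K (f (MvPolynomial.X i) - algebraMap K _ (lam i)) := by
      obtain ⟨k, hk⟩ := h2
      refine ⟨Polynomial.X ^ k, Polynomial.monic_X_pow k, by simp [hk]⟩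
    have := h3.add (isIntegral_algebraMap (R := K) (A := Dn K n ⧸ I) (x := lam i))
    rwa [sub_add_cancel] at this
  have hint : Algebra.IsIntegral K (Dn K n ⧸ I) := by
    constructor
    intro y
    obtain ⟨p, rfl⟩ := hf y
    induction p using MvPolynomial.induction_on with
    | C a =>
      have : f (MvPolynomial.C a) = algebraMap K _ a := f.commutes a
      rw [this]; exact isIntegral_algebraMap
    | add p q hp hq => rw [map_add]; exact hp.add hq
    | mul_X p i hp => rw [map_mul]; exact hp.mul (hH i)
  have hft : Algebra.FiniteType K (Dn K n ⧸ I) := Algebra.FiniteType.of_surjective f hf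
  have hfin : Module.Finite K (Dn K n ⧸ I) := Algebra.IsIntegral.finite
  let e := Ideal.quotTorsionOfEquivSpanSingleton (Dn K n) N x
  exact Module.Finite.equiv (e.restrictScalars K)

lemma lf_gws (lam : Fin n → K) (M : Type*) [AddCommGroup M] [Module K M] [Module (In K n) M]
    [IsScalarTower K (In K n) M] : IsLF K n lam (genWeightSpace K n M lam) := by
  rintro ⟨x, s, hs⟩
  have : ∀ i, ((HElD K n i - algebraMap K (Dn K n) (lam i)) ^ s) •
      (⟨x, s, hs⟩ : genWeightSpace K n M lam) = 0 := by
    intro i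
    apply Subtype.ext
    show dnVal K n _ • x = 0
    rw [map_pow, map_sub, dnVal_algebraMap]
    exact hs i
  exact ⟨lf_of K n lam _ _ s this, s, this⟩

end PartC

noncomputable section PartD
variable (K : Type*) [Field K] [CharZero K] (n : ℕ)
variable {N : Type*} [AddCommGroup N] [Module (Dn K n) N]

lemma kil_ind : Kil K n (Ind K n N) := by
  intro a ha w
  show toBn K n a • w = 0
  rw [ha, zero_smul]

/-- the map `N → Ind N` -/
def iN (x : N) : Ind K n N := (1 : Bn K n) ⊗ₜ[Dn K n] x

/-- pure tensors of `Ind N` -/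
def tm (b : Bn K n) (x : N) : Ind K n N := b ⊗ₜ[Dn K n] x

lemma smul_tm (a : In K n) (b : Bn K n) (x : N) : a • tm K n b x = tm K n (toBn K n a * b) x := rfl

lemma tm_smul (d : Dn K n) (b : Bn K n) (x : N) : tm K n (b * bnD K n d) x = tm K n b (d • x) :=
  TensorProduct.smul_tmul d b x

lemma iN_add (x y : N) : iN K n (x + y) = iN K n x + iN K n y := TensorProduct.tmul_add _ _ _

lemma iN_zero : iN K n (0 : N) = 0 := TensorProduct.tmul_zero _ _

lemma dn_iN (d : Dn K n) (x : N) : dnVal K n d • iN K n x = iN K n (d • x) := by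
  show _ • tm K n 1 x = tm K n 1 (d • x)
  rw [smul_tm, ← tm_smul, mul_one, one_mul]; rfl

lemma iN_inj : Function.Injective (iN K n : N → Ind K n N) := by
  obtain ⟨π, hπ⟩ := exists_pi K n
  have : Function.LeftInverse
      (fun w : Ind K n N => TensorProduct.lid (Dn K n) N (LinearMap.rTensor N π w))
      (iN K n) := by
    intro x
    show TensorProduct.lid (Dn K n) N (LinearMap.rTensor N π ((1 : Bn K n) ⊗ₜ[Dn K n] x)) = x
    rw [LinearMap.rTensor_tmul, hπ, TensorProduct.lid_tmul, one_smul]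
  exact this.injective

lemma tl_iN (z : Fin n → ℤ) (x : N) : tl K n z • iN K n x = tm K n (TT K n z) x := by
  show _ • tm K n 1 x = _
  rw [smul_tm, tl_spec, mul_one]

variable (N) in
/-- the homogeneous components of `Ind N` -/
def WN (z : Fin n → ℤ) : Submodule K (Ind K n N) where
  carrier := {w | ∃ x : N, w = tl K n z • iN K n x}
  add_mem' := by
    rintro _ _ ⟨x, rfl⟩ ⟨y, rfl⟩
    exact ⟨x + y, by rw [iN_add, smul_add]⟩
  zero_mem' := ⟨0, by rw [iN_zero, smul_zero]⟩
  smul_mem' := by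
    rintro c _ ⟨x, rfl⟩
    refine ⟨algebraMap K (Dn K n) c • x, ?_⟩
    rw [← dn_iN, dnVal_algebraMap, algebraMap_smul, smulK_comm]

lemma WN_top : ⨆ z, WN K n N z = ⊤ := by
  rw [eq_top_iff]
  intro w _
  have key : ∀ (b : Bn K n) (x : N), tm K n b x ∈ ⨆ z, WN K n N z := by
    intro b
    have hb : b ∈ Submodule.span (Dn K n) (Set.range fun z => (TT K n z : Bn K n)) := by
      rw [span_TT]; trivial
    induction hb using Submodule.span_induction with
    | mem b h =>
      obtain ⟨z, rfl⟩ := h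
      intro x
      exact (le_iSup (WN K n N) z) ⟨x, (tl_iN K n z x).symm⟩
    | zero =>
      intro x
      have : tm K n 0 x = 0 := TensorProduct.zero_tmul _ _
      rw [this]; exact Submodule.zero_mem _
    | add a b _ _ ha hb =>
      intro x
      have : tm K n (a + b) x = tm K n a x + tm K n b x := TensorProduct.add_tmul _ _ _
      rw [this]; exact Submodule.add_mem _ (ha x) (hb x)
    | smul d b _ hb => intro x; rw [smul_def_Bn, tm_smul]; exact hb _
  refine TensorProduct.induction_on (motive := fun w : (Bn K n) ⊗[Dn K n] N =>
    (show Ind K n N from w) ∈ ⨆ z, WN K n N z) w (Submodule.zero_mem _) key ?_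
  intro x y hx hy
  exact Submodule.add_mem _ hx hy

section LF
variable [Module K N] [IsScalarTower K (Dn K n) N] {lam : Fin n → K}

lemma iN_mem (h : IsLF K n lam N) (x : N) : iN K n x ∈ genWeightSpace K n (Ind K n N) lam := by
  obtain ⟨-, s, hs⟩ := h x
  refine ⟨s, fun i => ?_⟩
  rw [← dnVal_HElD, ← dnVal_algebraMap, ← map_sub, ← map_pow, dn_iN, hs, iN_zero]

lemma WN_le (h : IsLF K n lam N) (z : Fin n → ℤ) :
    WN K n N z ≤ genWeightSpace K n (Ind K n N) (lam + zc K n z) := by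
  rintro _ ⟨x, rfl⟩
  exact tl_mem K n (kil_ind K n) z (iN_mem K n h x)

lemma orb_ind (h : IsLF K n lam N) : Orb K n (Ind K n N) lam := by
  rw [Orb, eq_top_iff, ← WN_top]
  exact iSup_mono (WN_le K n h)

lemma gws_ind (h : IsLF K n lam N) {w : Ind K n N} (hw : w ∈ genWeightSpace K n (Ind K n N) lam) :
    ∃ x : N, w = iN K n x := by
  have hinj : Function.Injective (fun z : Fin n → ℤ => lam + zc K n z) := by
    intro z w hzw
    funext i
    have := congrFun (add_left_cancel hzw) i
    simpa [zc] using this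
  have hind := (gws_indep K n (M := Ind K n N)).comp hinj
  have h0 : lam + zc K n 0 = lam := by funext i; simp [zc]
  have ht : w ∈ ⨆ z, WN K n N z := by rw [WN_top]; trivial
  have hs : (⨆ z, WN K n N z) ≤ WN K n N 0 ⊔ ⨆ z, ⨆ (_ : z ≠ 0), WN K n N z := by
    refine iSup_le fun z => ?_
    by_cases hz : z = 0
    · subst hz; exact le_sup_left
    · exact le_sup_of_le_right (le_iSup₂_of_le (f := fun z (_ : z ≠ 0) => WN K n N z) z hz le_rfl)
  obtain ⟨a, ha, b, hb, rfl⟩ := Submodule.mem_sup.1 (hs ht)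
  have ha' := WN_le K n h 0 ha
  rw [h0] at ha'
  have hb' : b ∈ genWeightSpace K n (Ind K n N) lam := by
    have := Submodule.sub_mem _ hw ha'
    rwa [add_sub_cancel_left] at this
  have hb0 : b = 0 := by
    refine Submodule.disjoint_def.1 (hind 0) b ?_ ?_
    · show b ∈ genWeightSpace K n (Ind K n N) (lam + zc K n 0)
      rwa [h0]
    · exact (iSup₂_mono fun z _ => WN_le K n h z) hb
  obtain ⟨x, hx⟩ := ha
  exact ⟨x, by rw [hb0, add_zero, hx, tl_zero K n (kil_ind K n)]⟩

lemma gws_equiv (h : IsLF K n lam N) :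
    Nonempty ((genWeightSpace K n (Ind K n N) lam) ≃ₗ[Dn K n] N) := by
  let f : N →ₗ[Dn K n] genWeightSpace K n (Ind K n N) lam :=
    { toFun := fun x => ⟨iN K n x, iN_mem K n h x⟩
      map_add' := fun x y => Subtype.ext (iN_add K n x y)
      map_smul' := fun d x => Subtype.ext (dn_iN K n d x).symm }
  refine ⟨(LinearEquiv.ofBijective f ⟨?_, ?_⟩).symm⟩
  · intro x y hxy
    exact iN_inj K n (congrArg Subtype.val hxy)
  · rintro ⟨w, hw⟩
    obtain ⟨x, rfl⟩ := gws_ind K n h hw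
    exact ⟨x, rfl⟩

end LF

lemma ind_lift {M' : Type*} [AddCommGroup M'] [Module (In K n) M'] (h : Kil K n M')
    (g : N →+ M') (hg : ∀ (d : Dn K n) x, g (d • x) = dnVal K n d • g x) :
    ∃ F : Ind K n N →ₗ[In K n] M', ∀ x, F (iN K n x) = g x := by
  let c : Bn K n → In K n := fun b => (toBn_surjective K n b).choose
  have hc : ∀ b, toBn K n (c b) = b := fun b => (toBn_surjective K n b).choose_spec
  let f : Bn K n →+ N →+ M' :=
    { toFun := fun b =>
        { toFun := fun x => c b • g x
          map_zero' := by rw [map_zero, smul_zero]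
          map_add' := fun x y => by rw [map_add, smul_add] }
      map_zero' := by
        ext x
        show c 0 • g x = 0
        exact h _ (hc 0) _
      map_add' := fun a b => by
        ext x
        show c (a + b) • g x = c a • g x + c b • g x
        rw [← add_smul]
        apply kil_eq K n h
        rw [map_add, hc, hc, hc] }
  let F0 : (Bn K n) ⊗[Dn K n] N →+ M' := TensorProduct.liftAddHom f (by
    intro d b x
    show c (d • b) • g x = c b • g (d • x)
    rw [hg, ← mul_smul]
    apply kil_eq K n h
    rw [map_mul, hc, hc]; rfl)
  have hF : ∀ b x, F0 (tm K n b x) = c b • g x := fun b x => rfl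
  refine ⟨{ toFun := F0, map_add' := F0.map_add, map_smul' := ?_ }, ?_⟩
  · intro a w
    refine TensorProduct.induction_on (motive := fun w : (Bn K n) ⊗[Dn K n] N =>
      F0 (a • (show Ind K n N from w)) = a • F0 w) w ?_ ?_ ?_
    · show F0 (a • (0 : Ind K n N)) = a • F0 0
      rw [smul_zero, map_zero, smul_zero]; exact map_zero F0
    · intro b x
      show F0 (a • tm K n b x) = a • F0 (tm K n b x)
      rw [smul_tm, hF, hF, ← mul_smul]
      apply kil_eq K n h
      rw [map_mul, hc, hc]
    · intro x y hx hy
      have : F0 (a • (show Ind K n N from x) + a • (show Ind K n N from y)) = a • F0 x + a • F0 y := by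
        rw [← hx, ← hy]; exact map_add F0 _ _
      rw [map_add, smul_add, ← this, ← smul_add]; rfl
  · intro x
    show F0 (tm K n 1 x) = _
    rw [hF]
    rw [kil_eq K n h (b := 1), one_smul]
    rw [hc, map_one]

end PartD

noncomputable section PartE
universe u
variable (K : Type u) [Field K] [CharZero K] (n : ℕ)

lemma dx_xd (i : Fin n) : dEl K n i * xEl K n i = xEl K n i * dEl K n i + 1 := by
  apply ext_mon
  intro α
  have h := hEl_monomial K n i α 1
  rw [HEl] at h
  rw [h, add_smul, add_smul (xEl K n i * dEl K n i), mul_smul, d_mon, smulK_comm, x_mon, one_smul, one_smul]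
  congr 1
  by_cases h0 : α i = 0
  · simp [h0]
  · rw [tsub_add_cancel_of_le]
    rw [Finsupp.single_le_iff]; omega

lemma e0_x (i : Fin n) : (1 - intEl K n i * dEl K n i) * xEl K n i = 0 := by
  rw [sub_mul, one_mul, mul_assoc]
  show _ - intEl K n i * HEl K n i = 0
  rw [← x_eq, sub_self]

lemma e0_int (i : Fin n) : (1 - intEl K n i * dEl K n i) * intEl K n i = 0 := by
  rw [sub_mul, one_mul, mul_assoc, d_int, mul_one, sub_self]

/-- abbreviation -/
def e0 : In K 1 := 1 - intEl K 1 0 * dEl K 1 0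

lemma e1_eq (s t : ℕ) : eEl1 K s t = intEl K 1 0 ^ s * (e0 K * dEl K 1 0 ^ t) := by
  rw [← mul_assoc]; exact e_eq K 1 0 s t

lemma e0t_mem (t : ℕ) : e0 K * dEl K 1 0 ^ t ∈ Fideal K := by
  apply Submodule.subset_span
  exact ⟨0, t, by rw [e1_eq, pow_zero, one_mul]⟩

lemma F_mul {b : In K 1} (hb : ∀ t, e0 K * dEl K 1 0 ^ t * b ∈ Fideal K) :
    ∀ f ∈ Fideal K, f * b ∈ Fideal K := by
  intro f hf
  induction hf using Submodule.span_induction with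
  | mem x h =>
    obtain ⟨s, t, rfl⟩ := h
    rw [e1_eq, mul_assoc]
    exact Submodule.smul_mem _ (intEl K 1 0 ^ s) (hb t)
  | zero => rw [zero_mul]; exact Submodule.zero_mem _
  | add x y _ _ hx hy => rw [add_mul]; exact Submodule.add_mem _ hx hy
  | smul a x _ hx => rw [smul_eq_mul, mul_assoc]; exact Submodule.smul_mem _ a hx

lemma F_right (a : In K 1) : ∀ f ∈ Fideal K, f * a ∈ Fideal K := by
  have hd : ∀ f ∈ Fideal K, f * dEl K 1 0 ∈ Fideal K := by
    apply F_mul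
    intro t
    rw [mul_assoc, ← pow_succ]; exact e0t_mem K _
  induction a using In_induction with
  | hK c =>
    intro f hf
    rw [← Algebra.commutes]
    exact Submodule.smul_mem _ _ hf
  | hx i =>
    obtain rfl : i = 0 := Subsingleton.elim _ _
    apply F_mul
    intro t
    induction t with
    | zero =>
      rw [pow_zero, mul_one, e0, e0_x]; exact Submodule.zero_mem _
    | succ t ih =>
      have : e0 K * dEl K 1 0 ^ (t + 1) * xEl K 1 0
          = e0 K * dEl K 1 0 ^ t * xEl K 1 0 * dEl K 1 0 + e0 K * dEl K 1 0 ^ t := by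
        rw [pow_succ, mul_assoc, mul_assoc (dEl K 1 0 ^ t), dx_xd, mul_add, mul_add, mul_one]
        simp only [mul_assoc]
      rw [this]
      exact Submodule.add_mem _ (hd _ ih) (e0t_mem K t)
  | hd i =>
    obtain rfl : i = 0 := Subsingleton.elim _ _
    exact hd
  | hi i =>
    obtain rfl : i = 0 := Subsingleton.elim _ _
    apply F_mul
    intro t
    cases t with
    | zero => rw [pow_zero, mul_one, e0, e0_int]; exact Submodule.zero_mem _
    | succ t => rw [pow_succ, mul_assoc, mul_assoc, d_int, mul_one]; exact e0t_mem K t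
  | hadd a b ha hb => intro f hf; rw [mul_add]; exact Submodule.add_mem _ (ha f hf) (hb f hf)
  | hmul a b ha hb => intro f hf; rw [← mul_assoc]; exact hb _ (ha f hf)

lemma kil_msl (s : ℕ) (mu : K) : Kil K 1 (Msl K s mu) := by
  apply kil_of
  intro i m
  obtain rfl : i = 0 := Subsingleton.elim _ _
  obtain ⟨a, rfl⟩ := Submodule.Quotient.mk_surjective (MslIdeal K s mu) m
  show Submodule.Quotient.mk (intEl K 1 0 • dEl K 1 0 • a) = _
  symm
  rw [Submodule.Quotient.eq]
  apply Submodule.mem_sup_left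
  have : a - intEl K 1 0 • dEl K 1 0 • a = e0 K * dEl K 1 0 ^ 0 * a := by
    rw [smul_eq_mul, smul_eq_mul, pow_zero, mul_one, e0, sub_mul, one_mul, mul_assoc]
  rw [this]
  exact F_right K a _ (e0t_mem K 0)

/-- generator of `M(1, mu)` -/
def v0 (mu : K) : Msl K 1 mu := Submodule.Quotient.mk (p := MslIdeal K 1 mu) 1

lemma v0_span (mu : K) : Submodule.span (In K 1) {v0 K mu} = ⊤ := by
  rw [Submodule.span_singleton_eq_top_iff]
  intro v
  obtain ⟨a, rfl⟩ := Submodule.Quotient.mk_surjective (MslIdeal K 1 mu) v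
  refine ⟨a, ?_⟩
  show Submodule.Quotient.mk (a • 1) = _
  rw [smul_eq_mul, mul_one]

lemma v0_eig (mu : K) (i : Fin 1) : HEl K 1 i • v0 K mu = mu • v0 K mu := by
  obtain rfl : i = 0 := Subsingleton.elim _ _
  rw [← algebraMap_smul (In K 1) mu (v0 K mu), ← sub_eq_zero, ← sub_smul]
  show Submodule.Quotient.mk ((HEl K 1 0 - algebraMap K (In K 1) mu) • 1) = (0 : _ ⧸ MslIdeal K 1 mu)
  rw [Submodule.Quotient.mk_eq_zero]
  apply Submodule.mem_sup_right
  apply Submodule.subset_span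
  rw [smul_eq_mul, mul_one, pow_one]; rfl

lemma F_ker (f : In K 1) (hf : f ∈ Fideal K) : toBn K 1 f = 0 := by
  induction hf using Submodule.span_induction with
  | mem x h =>
    obtain ⟨s, t, rfl⟩ := h
    rw [e1_eq, map_mul, map_mul, e0, (toBn_eq_zero K 1 _).2 (e00_mem K 1 0), zero_mul, mul_zero]
  | zero => exact map_zero _
  | add x y _ _ hx hy => rw [map_add, hx, hy, add_zero]
  | smul b x _ hx => rw [smul_eq_mul, map_mul, hx, mul_zero]

lemma v0_ne (mu : K) : v0 K mu ≠ 0 := by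
  intro h
  have h1 : (1 : In K 1) ∈ MslIdeal K 1 mu := (Submodule.Quotient.mk_eq_zero _).1 h
  obtain ⟨f, hf, g, hg, hfg⟩ := Submodule.mem_sup.1 h1
  obtain ⟨a, rfl⟩ := Submodule.mem_span_singleton.1 hg
  have hf0 : toBn K 1 f = 0 := F_ker K f hf
  obtain ⟨π, hπ⟩ := exists_pi K 1
  obtain ⟨ev, hev⟩ := exists_ev K 1 (fun _ => mu)
  have h2 := congrArg (toBn K 1) hfg
  rw [map_add, hf0, zero_add, map_one, smul_eq_mul, map_mul, pow_one] at h2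
  have h3 : (HElD K 1 0 - algebraMap K (Dn K 1) mu) • toBn K 1 a = 1 := by
    rw [smul_def_Bn, ← h2, map_sub, map_sub, bnD_algebraMap]; rfl
  have h4 := congrArg ev (congrArg π h3)
  rw [map_smul, hπ, smul_eq_mul, map_mul, map_sub, hev, AlgHom.commutes, map_one] at h4
  simp at h4

section eig
variable {S : Type*} [AddCommGroup S] [Module K S] [Module (In K n) S] [IsScalarTower K (In K n) S]
  {lam : Fin n → K} {v : S}

lemma dn_eig (hv : ∀ i, HEl K n i • v = lam i • v) (d : Dn K n) :
    ∃ c : K, dnVal K n d • v = c • v := by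
  obtain ⟨p, rfl⟩ := dnP_surj K n d
  induction p using MvPolynomial.induction_on with
  | C a =>
    refine ⟨a, ?_⟩
    have : dnP K n (MvPolynomial.C a) = algebraMap K _ a := (dnP K n).commutes a
    rw [this, dnVal_algebraMap, algebraMap_smul]
  | add p q hp hq =>
    obtain ⟨c, hc⟩ := hp
    obtain ⟨c', hc'⟩ := hq
    exact ⟨c + c', by rw [map_add, map_add, add_smul, add_smul, hc, hc']⟩
  | mul_X p i hp =>
    obtain ⟨c, hc⟩ := hp
    refine ⟨lam i * c, ?_⟩
    have : dnP K n (MvPolynomial.X i) = HElD K n i := by rw [dnP, MvPolynomial.aeval_X]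
    rw [map_mul, map_mul, this, dnVal_HElD, mul_smul, hv, smulK_comm, hc, mul_smul]

lemma exists_basis (h : Kil K n S) (hv : ∀ i, HEl K n i • v = lam i • v) (h0 : v ≠ 0)
    (hs : Submodule.span (In K n) {v} = ⊤) :
    ∃ b : Module.Basis (Fin n → ℤ) K S, ∀ z, b z = tl K n z • v := by
  have hinj : Function.Injective (fun z : Fin n → ℤ => lam + zc K n z) := by
    intro z w hzw
    funext i
    have := congrFun (add_left_cancel hzw) i
    simpa [zc] using this
  have hind := (gws_indep K n (M := S)).comp hinj
  have hli : LinearIndependent K (fun z => tl K n z • v) := by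
    refine hind.linearIndependent _ (fun z => tl_mem K n h z (gws_of_eig K n hv)) ?_
    intro z hz
    apply h0
    rw [← tl_zero K n h v, ← neg_add_cancel z, ← tl_add K n h, hz, smul_zero]
  have hsp : ∀ b ∈ Submodule.span (Dn K n) (Set.range fun z => (TT K n z : Bn K n)),
      ∀ a, toBn K n a = b → a • v ∈ Submodule.span K (Set.range fun z => tl K n z • v) := by
    intro b hb
    induction hb using Submodule.span_induction with
    | mem x hx =>
      obtain ⟨z, rfl⟩ := hx
      intro a ha
      rw [kil_eq K n h (ha.trans (tl_spec K n z).symm)]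
      exact Submodule.subset_span ⟨z, rfl⟩
    | zero => intro a ha; rw [h a ha]; exact Submodule.zero_mem _
    | add x y _ _ hx hy =>
      intro a ha
      obtain ⟨a1, ha1⟩ := toBn_surjective K n x
      obtain ⟨a2, ha2⟩ := toBn_surjective K n y
      rw [kil_eq K n h (b := a1 + a2) (by rw [ha, map_add, ha1, ha2]), add_smul]
      exact Submodule.add_mem _ (hx _ ha1) (hy _ ha2)
    | smul d x _ hx =>
      intro a ha
      obtain ⟨a1, ha1⟩ := toBn_surjective K n x
      obtain ⟨c, hc⟩ := dn_eig K n hv d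
      rw [kil_eq K n h (b := a1 * dnVal K n d) (by rw [ha, map_mul, ha1]; rfl), mul_smul, hc,
        smulK_comm]
      exact Submodule.smul_mem _ _ (hx _ ha1)
  refine ⟨Module.Basis.mk hli ?_, fun z => Module.Basis.mk_apply _ _ z⟩
  intro s _
  obtain ⟨a, rfl⟩ := (Submodule.span_singleton_eq_top_iff _ _).1 hs s
  exact hsp (toBn K n a) (by rw [span_TT]; trivial) a rfl

lemma int_act (h : Kil K n S) (i : Fin n) (z : Fin n → ℤ) :
    intEl K n i • tl K n z • v = (1 : K) • tl K n (z + Pi.single i 1) • v := by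
  rw [int_tl K n h, tl_add K n h, one_smul, add_comm]

lemma d_act (h : Kil K n S) (i : Fin n) (z : Fin n → ℤ) :
    dEl K n i • tl K n z • v = (1 : K) • tl K n (z + Pi.single i (-1)) • v := by
  rw [d_tl K n h, tl_add K n h, one_smul, add_comm, Pi.single_neg]

lemma x_act (h : Kil K n S) (hv : ∀ i, HEl K n i • v = lam i • v) (i : Fin n) (z : Fin n → ℤ) :
    xEl K n i • tl K n z • v = (lam i + (z i : K)) • tl K n (z + Pi.single i 1) • v := by
  have h1 := H_tl K n h z i (lam i) 1 v
  rw [pow_one, pow_one, sub_smul (HEl K n i) _ v, hv, algebraMap_smul, sub_self, smul_zero,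
    sub_smul, algebraMap_smul, sub_eq_zero] at h1
  rw [x_eq, mul_smul, h1, smulK_comm, int_act K n h, one_smul]

/-- the factors -/
def MM (lam : Fin n → K) (i : Fin n) : ModN K 1 := ⟨Msl K 1 (lam i)⟩

lemma realizes (h : Kil K n S) (hv : ∀ i, HEl K n i • v = lam i • v) (h0 : v ≠ 0)
    (hs : Submodule.span (In K n) {v} = ⊤) : RealizesMD K n lam ∅ S := by
  refine ⟨MM K n lam, fun i hi => absurd hi (Set.notMem_empty i),
    fun i _ => ⟨LinearEquiv.refl _ _⟩, ?_⟩
  obtain ⟨b, hb⟩ := exists_basis K n h hv h0 hs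
  have hB : ∀ i, ∃ b : Module.Basis ℤ K (MM K n lam i).carrier,
      ∀ z, b z = tl K 1 (fun _ => z) • v0 K (lam i) := by
    intro i
    obtain ⟨b, hb⟩ := exists_basis K 1 (lam := fun _ => lam i) (kil_msl K 1 (lam i))
      (v0_eig K (lam i)) (v0_ne K _) (v0_span K _)
    refine ⟨b.reindex (Equiv.funUnique (Fin 1) ℤ), fun z => ?_⟩
    exact (Module.Basis.reindex_apply b (Equiv.funUnique (Fin 1) ℤ) z).trans (hb _)
  choose c hc using hB
  let B := Basis.piTensorProduct c
  let φ : S ≃ₗ[K] ⨂[K] j, (MM K n lam j).carrier := b.equiv B (Equiv.refl _)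
  have hφ : ∀ z, φ (tl K n z • v) = PiTensorProduct.tprod K (fun i => c i (z i)) := by
    intro z
    rw [← hb, Module.Basis.equiv_apply, Equiv.refl_apply, Basis.piTensorProduct_apply]
  have key : ∀ (a' : In K n) (a : In K 1) (i : Fin n) (w : ℤ) (k : ℤ → K)
      (h1 : ∀ z, a' • tl K n z • v = k (z i) • tl K n (z + Pi.single i w) • v)
      (h2 : ∀ ζ : ℤ, a • tl K 1 (fun _ => ζ) • v0 K (lam i)
        = k ζ • tl K 1 ((fun _ => ζ) + Pi.single 0 w) • v0 K (lam i)) (m : S),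
      φ (a' • m) = tprodMap K n (MM K n lam) i a (φ m) := by
    intro a' a i w k h1 h2 m
    have : (φ.toLinearMap ∘ₗ DistribMulAction.toLinearMap K S a')
        = tprodMap K n (MM K n lam) i a ∘ₗ φ.toLinearMap := by
      apply b.ext
      intro z
      show φ (a' • b z) = tprodMap K n (MM K n lam) i a (φ (b z))
      rw [hb, h1, map_smul, hφ, hφ, tprodMap, PiTensorProduct.map_tprod]
      have h3 : (fun j => (Function.update
          (fun j => (LinearMap.id : (MM K n lam j).carrier →ₗ[K] (MM K n lam j).carrier)) i
          (DistribMulAction.toLinearMap K ((MM K n lam i).carrier) a)) j (c j (z j)))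
          = Function.update (fun j => c j ((z + Pi.single i w : Fin n → ℤ) j)) i
            (k (z i) • c i ((z + Pi.single i w : Fin n → ℤ) i)) := by
        funext j
        by_cases hj : j = i
        · subst hj
          rw [Function.update_self, Function.update_self]
          show a • c j (z j) = _
          rw [hc, hc]
          refine (h2 (z j)).trans ?_
          congr 3
          funext l
          simp [Subsingleton.elim l 0]
        · rw [Function.update_of_ne hj, Function.update_of_ne hj]
          simp [hj]
      rw [h3, MultilinearMap.map_update_smul, Function.update_eq_self]
    exact LinearMap.congr_fun this m
  refine ⟨φ, fun i m => ⟨?_, ?_, ?_⟩⟩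
  · refine key _ _ i 1 (fun ζ => lam i + (ζ : K)) (fun z => x_act K n h hv i z) (fun ζ => ?_) m
    exact x_act K 1 (lam := fun _ => lam i) (kil_msl K 1 (lam i)) (v0_eig K (lam i)) 0 _
  · exact key _ _ i (-1) (fun _ => 1) (fun z => d_act K n h i z)
      (fun ζ => d_act K 1 (kil_msl K 1 (lam i)) 0 _) m
  · exact key _ _ i 1 (fun _ => 1) (fun z => int_act K n h i z)
      (fun ζ => int_act K 1 (kil_msl K 1 (lam i)) 0 _) m

lemma realizes_int_d (h : RealizesMD K n lam ∅ S) (i : Fin n) (s : S) :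
    intEl K n i • dEl K n i • s = s := by
  obtain ⟨Mi, -, h1, φ, hφ⟩ := h
  apply φ.injective
  rw [(hφ i _).2.2, (hφ i _).2.1]
  obtain ⟨e⟩ := h1 i (Set.notMem_empty i)
  have hk := kil_equiv K 1 e (kil_msl K 1 (lam i))
  rw [tprodMap, tprodMap, ← LinearMap.comp_apply, ← PiTensorProduct.map_comp]
  have : (fun j => Function.update
      (fun j => (LinearMap.id : (Mi j).carrier →ₗ[K] (Mi j).carrier)) i
      (DistribMulAction.toLinearMap K ((Mi i).carrier) (intEl K 1 0)) j ∘ₗ Function.update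
      (fun j => (LinearMap.id : (Mi j).carrier →ₗ[K] (Mi j).carrier)) i
      (DistribMulAction.toLinearMap K ((Mi i).carrier) (dEl K 1 0)) j)
      = fun j => LinearMap.id := by
    funext j
    by_cases hj : j = i
    · subst hj
      rw [Function.update_self, Function.update_self]
      ext m
      exact kil_int_d K 1 hk 0 m
    · rw [Function.update_of_ne hj, Function.update_of_ne hj]; rfl
  rw [this, PiTensorProduct.map_id]
  rfl

end eig

section fin
variable {M : Type*} [AddCommGroup M] [Module K M] [Module (In K n) M] [IsScalarTower K (In K n) M]
  {lam : Fin n → K}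

lemma kil_gwd (h : InGWD K n lam ∅ M) : Kil K n M := by
  apply kil_of
  intro i m
  by_contra hne
  have hv0 : m - intEl K n i • dEl K n i • m ≠ 0 := fun h => hne (sub_eq_zero.1 h).symm
  have hd : dEl K n i • (m - intEl K n i • dEl K n i • m) = 0 := by
    rw [smul_sub, ← mul_smul, d_int, one_smul, sub_self]
  generalize m - intEl K n i • dEl K n i • m = v at hv0 hd
  let q := Submodule.span (In K n) {v}
  let w : q := ⟨v, Submodule.mem_span_singleton_self v⟩
  have : Nontrivial q := ⟨w, 0, fun h => hv0 (congrArg Subtype.val h)⟩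
  have : Module.Finite (In K n) q := Module.Finite.span_singleton _ _
  obtain ⟨p', hp', -⟩ := (eq_top_or_exists_le_coatom (⊥ : Submodule (In K n) q)).resolve_left bot_ne_top
  have hcm : Submodule.comap q.subtype (p'.map q.subtype) = p' :=
    Submodule.comap_map_eq_of_injective q.subtype_injective p'
  have h1 := h.2.2 (p'.map q.subtype) q (Submodule.map_subtype_le q p')
    (by rw [hcm]; exact isSimpleModule_iff_isCoatom.2 hp')
  have h2 := realizes_int_d K n h1 i (Submodule.Quotient.mk w)
  have h3 : dEl K n i • w = 0 := Subtype.ext hd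
  rw [← Submodule.Quotient.mk_smul, h3, Submodule.Quotient.mk_zero, smul_zero] at h2
  have h4 := (Submodule.Quotient.mk_eq_zero _).1 h2.symm
  rw [hcm] at h4
  apply hp'.1
  rw [eq_top_iff]
  rintro ⟨x, hx⟩ -
  obtain ⟨a, rfl⟩ := Submodule.mem_span_singleton.1 hx
  exact p'.smul_mem a h4

lemma gwd_of (hk : Kil K n M) (ho : Orb K n M lam) : InGWD K n lam ∅ M := by
  refine ⟨((orb_iff K n lam).1 ho).1, ((orb_iff K n lam).1 ho).2, fun p q hpq hS => ?_⟩
  have hkS : Kil K n (q ⧸ Submodule.comap q.subtype p) := kil_quot K n (kil_sub K n hk q) _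
  have : Nontrivial (q ⧸ Submodule.comap q.subtype p) := IsSimpleModule.nontrivial (In K n) _
  obtain ⟨s, hs⟩ := exists_ne (0 : q ⧸ Submodule.comap q.subtype p)
  have hz : ZP K n lam s := by
    obtain ⟨x, rfl⟩ := Submodule.Quotient.mk_surjective _ s
    intro i
    obtain ⟨l, hl⟩ := zp_of_orb K n ho (x : M) i
    refine ⟨l, ?_⟩
    have : dnVal K n ((l.map (hD K n lam i)).prod) • x = 0 := Subtype.ext hl
    rw [← Submodule.Quotient.mk_smul, this, Submodule.Quotient.mk_zero]
  obtain ⟨a, ha, hv⟩ := exists_eig K n hkS hs hz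
  exact realizes K n hkS hv ha (IsSimpleModule.span_singleton_eq_top (In K n) ha)

lemma ind_iso (hk : Kil K n M) (ho : Orb K n M lam) :
    ∃ e : Ind K n (genWeightSpace K n M lam) ≃ₗ[In K n] M,
      ∀ x : genWeightSpace K n M lam, e (iN K n x) = x := by
  obtain ⟨F, hF⟩ := ind_lift K n hk (genWeightSpace K n M lam).subtype.toAddMonoidHom
    (fun d x => rfl)
  have hlf := lf_gws K n lam M
  refine ⟨LinearEquiv.ofBijective F ⟨?_, ?_⟩, hF⟩
  · rw [← LinearMap.ker_eq_bot, Submodule.eq_bot_iff]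
    intro w hw
    by_contra hne
    obtain ⟨a, ha, hv⟩ := exists_eig K n (kil_ind K n) hne (zp_of_orb K n (orb_ind K n hlf) w)
    obtain ⟨x, hx⟩ := gws_ind K n hlf (gws_of_eig K n hv)
    have h1 : F (a • w) = 0 := by rw [map_smul, LinearMap.mem_ker.1 hw, smul_zero]
    rw [hx, hF] at h1
    apply ha
    have : x = 0 := Subtype.ext h1
    rw [hx, this, iN_zero]
  · rw [← LinearMap.range_eq_top]
    apply sub_top K n hk ho
    intro m hm
    exact ⟨iN K n ⟨m, hm⟩, hF ⟨m, hm⟩⟩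

lemma orb_gwd (h : InGWD K n lam ∅ M) : Orb K n M lam := (orb_iff K n lam).2 ⟨h.1, h.2.1⟩

end fin

end PartE

/-- for `𝒟_Ω = ∅`, the functor `M ↦ M^𝔪` is an equivalence of categories
`GW(𝕀_n, 𝒟_Ω) → LF_𝔪(D_n)` (fully faithful, with values in `LF_𝔪(D_n)`), with inverse the
induction functor `N ↦ B_n ⊗_{D_n} N`. -/
theorem statement13 (K : Type*) [Field K] [CharZero K] (n : ℕ)
    (lam : Fin n → K) (hnorm : IsNormalized K n lam) :
    (∀ (M M' : Type*) [AddCommGroup M] [Module K M] [Module (In K n) M] [IsScalarTower K (In K n) M] [AddCommGroup M'] [Module K M'] [Module (In K n) M'] [IsScalarTower K (In K n) M'],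
      InGWD K n lam ∅ M → InGWD K n lam ∅ M' →
      (∀ g : genWeightSpace K n M lam →ₗ[Dn K n] genWeightSpace K n M' lam,
        ∃! f : M →ₗ[In K n] M', ∀ (x : M) (hx : x ∈ genWeightSpace K n M lam),
          f x = (g ⟨x, hx⟩ : M')) ∧
      (∀ f : M →ₗ[In K n] M',
        ∃ g : genWeightSpace K n M lam →ₗ[Dn K n] genWeightSpace K n M' lam,
        ∀ (x : M) (hx : x ∈ genWeightSpace K n M lam), f x = (g ⟨x, hx⟩ : M'))) ∧
    (∀ (M : Type*) [AddCommGroup M] [Module K M] [Module (In K n) M] [IsScalarTower K (In K n) M], InGWD K n lam ∅ M →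
      IsLF K n lam (genWeightSpace K n M lam) ∧
      Nonempty ((Ind K n (genWeightSpace K n M lam)) ≃ₗ[In K n] M)) ∧
    (∀ (N : Type*) [AddCommGroup N] [Module K N] [Module (Dn K n) N]
      [IsScalarTower K (Dn K n) N], IsLF K n lam N →
      InGWD K n lam ∅ (Ind K n N) ∧
      IsLF K n lam (genWeightSpace K n (Ind K n N) lam) ∧
      Nonempty ((genWeightSpace K n (Ind K n N) lam) ≃ₗ[Dn K n] N)) := by
  refine ⟨?_, ?_, ?_⟩
  · intro M M' _ _ _ _ _ _ _ _ hM hM'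
    have hk := kil_gwd K n hM
    have hk' := kil_gwd K n hM'
    have ho := orb_gwd K n hM
    refine ⟨?_, ?_⟩
    · intro g
      obtain ⟨e, he⟩ := ind_iso K n hk ho
      obtain ⟨F, hF⟩ := ind_lift K n hk'
        ((genWeightSpace K n M' lam).subtype.toAddMonoidHom.comp g.toAddMonoidHom)
        (fun d x => congrArg Subtype.val (g.map_smul d x))
      refine ⟨F ∘ₗ e.symm.toLinearMap, ?_, ?_⟩
      · intro x hx
        have : e.symm x = iN K n (⟨x, hx⟩ : genWeightSpace K n M lam) := by
          rw [LinearEquiv.symm_apply_eq, he]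
        show F (e.symm x) = _
        rw [this, hF]; rfl
      · intro f hf
        have htop : LinearMap.eqLocus f (F ∘ₗ e.symm.toLinearMap) = ⊤ := by
          apply sub_top K n hk ho
          intro x hx
          show f x = F (e.symm x)
          have : e.symm x = iN K n (⟨x, hx⟩ : genWeightSpace K n M lam) := by
            rw [LinearEquiv.symm_apply_eq, he]
          rw [hf x hx, this, hF]; rfl
        apply LinearMap.ext
        intro x
        have hx : x ∈ LinearMap.eqLocus f (F ∘ₗ e.symm.toLinearMap) := by rw [htop]; trivial
        exact hx
    · intro f
      refine ⟨{ toFun := fun x => ⟨f x, ?_⟩, map_add' := ?_, map_smul' := ?_ }, fun x hx => rfl⟩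
      · obtain ⟨x, s, hs⟩ := x
        exact ⟨s, fun i => by rw [← map_smul, hs, map_zero]⟩
      · intro x y; exact Subtype.ext (map_add f _ _)
      · intro d x; exact Subtype.ext (map_smul f _ _)
  · intro M _ _ _ _ hM
    obtain ⟨e, -⟩ := ind_iso K n (kil_gwd K n hM) (orb_gwd K n hM)
    exact ⟨lf_gws K n lam M, ⟨e⟩⟩
  · intro N _ _ _ _ hN
    exact ⟨gwd_of K n (kil_ind K n) (orb_ind K n hN), lf_gws K n lam _, gws_equiv K n hN⟩

end IDO
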